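/- There exist constants C_0, c_1 > 0 and absolute constants 0 < c ≤ C < ∞ such that the following holds for every integer n≥2 and real 0<q<1, with π distributed according to the (n,q)-Mallows measure: (a) if 1 − C_0/(log n)² ≤ q ≤ 1 − 4/n then c/√(1−q) ≤ E(LDS(π)) ≤ C/√(1−q); (b) if 1 − c_1(log log n)²/log n ≤ q ≤ 1 − C_0/(log n)² then c·(log n)/log((1−q)(log n)²) ≤ E(LDS(π)) ≤ C·(log n)/log((1−q)(log n)²); (c) if 1/n ≤ q ≤ 1 − c_1(log log n)²/log n then c·√(log n / log(1/q)) ≤ E(LDS(π)) ≤ C·√(log n / log(1/q)). -/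

import Mathlib

open Finset

/-- Number of inversions of a permutation of `Fin n`. -/
def mallowsInv {n : ℕ} (π : Equiv.Perm (Fin n)) : ℕ :=
  (Finset.univ.filter (fun p : Fin n × Fin n => p.1 < p.2 ∧ π p.2 < π p.1)).card

/-- The `(n,q)`-Mallows probability mass function on `S_n`. -/
noncomputable def mallowsPMF (n : ℕ) (q : ℝ) (π : Equiv.Perm (Fin n)) : ℝ :=
  q ^ mallowsInv π / ∑ σ : Equiv.Perm (Fin n), q ^ mallowsInv σ

/-- Probability of an event under the `(n,q)`-Mallows measure. -/
noncomputable def mallowsProb (n : ℕ) (q : ℝ) (A : Set (Equiv.Perm (Fin n))) : ℝ :=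
  ∑ π : Equiv.Perm (Fin n), A.indicator (mallowsPMF n q) π

/-- Expectation of a function under the `(n,q)`-Mallows measure. -/
noncomputable def mallowsExp (n : ℕ) (q : ℝ) (f : Equiv.Perm (Fin n) → ℝ) : ℝ :=
  ∑ π : Equiv.Perm (Fin n), mallowsPMF n q π * f π

/-- Length of the longest increasing subsequence of a permutation of `Fin n`. -/
noncomputable def LIS {n : ℕ} (π : Equiv.Perm (Fin n)) : ℕ :=
  sSup {m | ∃ f : Fin m → Fin n, StrictMono f ∧ StrictMono (fun j => π (f j))}

/-- Length of the longest decreasing subsequence of a permutation of `Fin n`. -/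
noncomputable def LDS {n : ℕ} (π : Equiv.Perm (Fin n)) : ℕ :=
  sSup {m | ∃ f : Fin m → Fin n, StrictMono f ∧ StrictAnti (fun j => π (f j))}

/-- The permutation with `π i = v` whose pattern on the remaining positions is `σ`. -/
noncomputable def insertPerm {N : ℕ} (i v : Fin (N + 1)) (σ : Equiv.Perm (Fin N)) :
    Equiv.Perm (Fin (N + 1)) :=
  (finSuccEquiv' i).trans ((Equiv.optionCongr σ).trans (finSuccEquiv' v).symm)

@[simp] lemma insertPerm_self {N : ℕ} (i v : Fin (N + 1)) (σ : Equiv.Perm (Fin N)) :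
    insertPerm i v σ i = v := by
  simp [insertPerm]

@[simp] lemma insertPerm_succAbove {N : ℕ} (i v : Fin (N + 1)) (σ : Equiv.Perm (Fin N))
    (j : Fin N) : insertPerm i v σ (i.succAbove j) = v.succAbove (σ j) := by
  simp [insertPerm]

lemma insertPerm_bijective {N : ℕ} (i : Fin (N + 1)) :
    Function.Bijective (fun p : Fin (N + 1) × Equiv.Perm (Fin N) => insertPerm i p.1 p.2) := by
  rw [Fintype.bijective_iff_injective_and_card]
  constructor
  · rintro ⟨v, σ⟩ ⟨w, τ⟩ h
    simp only at h
    have hv : v = w := by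
      have := congrArg (fun e : Equiv.Perm (Fin (N + 1)) => e i) h
      simpa using this
    subst hv
    refine Prod.ext rfl ?_
    ext j
    have := congrArg (fun e : Equiv.Perm (Fin (N + 1)) => e (i.succAbove j)) h
    simp only [insertPerm_succAbove] at this
    rw [Fin.succAbove_right_injective this]
  · simp [Fintype.card_perm, Nat.factorial_succ]

lemma sum_perm_succ {N : ℕ} (i : Fin (N + 1)) (F : Equiv.Perm (Fin (N + 1)) → ℝ) :
    ∑ π, F π = ∑ v, ∑ σ, F (insertPerm i v σ) := by
  rw [← (insertPerm_bijective i).sum_comp F, Fintype.sum_prod_type]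

lemma mallowsInv_eq_sum {n : ℕ} (π : Equiv.Perm (Fin n)) :
    mallowsInv π = ∑ a, ∑ b, if a < b ∧ π b < π a then 1 else 0 := by
  rw [mallowsInv, Finset.card_filter, Fintype.sum_prod_type]

lemma mallowsInv_insertPerm {N : ℕ} (i v : Fin (N + 1)) (σ : Equiv.Perm (Fin N)) :
    mallowsInv (insertPerm i v σ) = mallowsInv σ +
      ((univ.filter fun j : Fin N => j.castSucc < i ∧ v ≤ (σ j).castSucc).card +
        (univ.filter fun j : Fin N => i ≤ j.castSucc ∧ (σ j).castSucc < v).card) := by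
  rw [mallowsInv_eq_sum, mallowsInv_eq_sum, Fin.sum_univ_succAbove _ i]
  simp_rw [Fin.sum_univ_succAbove _ i]
  simp only [insertPerm_self, insertPerm_succAbove, Fin.succAbove_lt_succAbove_iff,
    Fin.succAbove_lt_iff_castSucc_lt, Fin.lt_succAbove_iff_le_castSucc, lt_irrefl, false_and,
    if_false, zero_add, Finset.sum_add_distrib, Finset.card_filter]
  ring

lemma mallowsInv_insertPerm_last {N : ℕ} (v : Fin (N + 1)) (σ : Equiv.Perm (Fin N)) :
    mallowsInv (insertPerm (Fin.last N) v σ) = mallowsInv σ + (N - v) := by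
  rw [mallowsInv_insertPerm]
  congr 1
  have h1 : (univ.filter fun j : Fin N => Fin.last N ≤ j.castSucc ∧ (σ j).castSucc < v) = ∅ := by
    ext j
    simp [Fin.le_def]
  have h2 : (univ.filter fun j : Fin N => j.castSucc < Fin.last N ∧ v ≤ (σ j).castSucc).card
      = (univ.filter fun j : Fin N => v ≤ j.castSucc).card := by
    refine Finset.card_bij (fun j _ => σ j) ?_ ?_ ?_
    · intro j hj
      simpa using hj
    · intro a _ b _ h
      exact σ.injective h
    · intro b hb
      exact ⟨σ.symm b, by simpa [Fin.castSucc_lt_last] using hb, by simp⟩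
  rw [h1, h2, Finset.card_empty, add_zero]
  have h3 : (univ.filter fun j : Fin N => v ≤ j.castSucc).card +
      (univ.filter fun j : Fin N => ¬ v ≤ j.castSucc).card = N := by
    rw [Finset.card_filter_add_card_filter_not]; simp
  have h4 : (univ.filter fun j : Fin N => ¬ v ≤ j.castSucc).card = v := by
    have : (univ.filter fun j : Fin N => ¬ v ≤ j.castSucc)
        = univ.filter fun j : Fin N => (j : ℕ) < v := by
      ext j; simp [Fin.lt_def]
    rw [this, Fin.card_filter_val_lt]
    omega
  omega

/-- The partition function of the Mallows measure. -/
noncomputable def mallowsZ (n : ℕ) (q : ℝ) : ℝ := ∑ σ : Equiv.Perm (Fin n), q ^ mallowsInv σ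

lemma mallowsZ_pos (n : ℕ) {q : ℝ} (hq : 0 < q) : 0 < mallowsZ n q :=
  Finset.sum_pos (fun _ _ => pow_pos hq _) Finset.univ_nonempty

lemma sum_pow_rev (N : ℕ) (q : ℝ) :
    ∑ v : Fin (N + 1), q ^ (N - (v : ℕ)) = ∑ k ∈ Finset.range (N + 1), q ^ k := by
  rw [Fin.sum_univ_eq_sum_range (fun k => q ^ (N - k)), ← Finset.sum_range_reflect]
  refine Finset.sum_congr rfl fun k hk => ?_
  congr 1
  have := Finset.mem_range.1 hk
  omega

lemma mallowsZ_succ (N : ℕ) (q : ℝ) :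
    mallowsZ (N + 1) q = mallowsZ N q * ∑ k ∈ Finset.range (N + 1), q ^ k := by
  rw [mallowsZ, sum_perm_succ (Fin.last N)]
  simp_rw [mallowsInv_insertPerm_last, pow_add, ← Finset.sum_mul]
  rw [← Finset.mul_sum, sum_pow_rev, mallowsZ]

lemma mallowsExp_eq (n : ℕ) (q : ℝ) (f : Equiv.Perm (Fin n) → ℝ) :
    mallowsExp n q f = (∑ π, q ^ mallowsInv π * f π) / mallowsZ n q := by
  rw [mallowsExp, Finset.sum_div]
  refine Finset.sum_congr rfl fun π _ => ?_
  rw [mallowsPMF, mallowsZ]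
  ring

lemma mallowsExp_mono {n : ℕ} {q : ℝ} (hq : 0 < q) {f g : Equiv.Perm (Fin n) → ℝ}
    (h : ∀ π, f π ≤ g π) : mallowsExp n q f ≤ mallowsExp n q g := by
  rw [mallowsExp_eq, mallowsExp_eq]
  have := mallowsZ_pos n hq
  gcongr with π
  exact h π

lemma mallowsExp_const (n : ℕ) {q : ℝ} (hq : 0 < q) (c : ℝ) :
    mallowsExp n q (fun _ => c) = c := by
  rw [mallowsExp_eq, ← Finset.sum_mul, ← mallowsZ]
  have := mallowsZ_pos n hq
  field_simp

/-- Average of a family of functions over the insertion of a new last entry. -/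
noncomputable def insertAvg (q : ℝ) (F : (k : ℕ) → Equiv.Perm (Fin k) → ℝ) (k : ℕ)
    (σ : Equiv.Perm (Fin k)) : ℝ :=
  (∑ v : Fin (k + 1), q ^ (k - (v : ℕ)) * F (k + 1) (insertPerm (Fin.last k) v σ)) /
    ∑ j ∈ Finset.range (k + 1), q ^ j

lemma mallowsExp_succ (n : ℕ) {q : ℝ} (hq : 0 < q) (F : (k : ℕ) → Equiv.Perm (Fin k) → ℝ) :
    mallowsExp (n + 1) q (F (n + 1)) = mallowsExp n q (insertAvg q F n) := by
  rw [mallowsExp_eq, mallowsExp_eq, mallowsZ_succ, sum_perm_succ (Fin.last n), Finset.sum_comm]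
  have hS : 0 < ∑ k ∈ Finset.range (n + 1), q ^ k :=
    Finset.sum_pos (fun _ _ => pow_pos hq _) (by simp)
  have hZ := mallowsZ_pos n hq
  rw [div_eq_div_iff (by positivity) (by positivity), Finset.sum_mul, Finset.sum_mul]
  refine Finset.sum_congr rfl fun σ _ => ?_
  simp_rw [mallowsInv_insertPerm_last, insertAvg, pow_add, mul_assoc, ← Finset.mul_sum]
  field_simp

lemma mallowsExp_add (n t : ℕ) {q : ℝ} (hq : 0 < q) (F : (k : ℕ) → Equiv.Perm (Fin k) → ℝ) :
    mallowsExp (n + t) q (F (n + t)) = mallowsExp n q ((insertAvg q)^[t] F n) := by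
  induction t generalizing F with
  | zero => rfl
  | succ t ih =>
    rw [Function.iterate_succ_apply, ← ih, ← add_assoc, mallowsExp_succ (n + t) hq]

lemma LDS_bddAbove {n : ℕ} (π : Equiv.Perm (Fin n)) :
    n ∈ upperBounds {m | ∃ f : Fin m → Fin n, StrictMono f ∧ StrictAnti (fun j => π (f j))} := by
  rintro m ⟨f, hf, -⟩
  simpa using Fintype.card_le_of_injective f hf.injective

lemma le_LDS {n m : ℕ} {π : Equiv.Perm (Fin n)} {f : Fin m → Fin n} (hf : StrictMono f)
    (hπ : StrictAnti (fun j => π (f j))) : m ≤ LDS π :=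
  le_csSup ⟨n, LDS_bddAbove π⟩ ⟨f, hf, hπ⟩

lemma exists_of_le_LDS {n m : ℕ} {π : Equiv.Perm (Fin n)} (h : m ≤ LDS π) :
    ∃ f : Fin m → Fin n, StrictMono f ∧ StrictAnti (fun j => π (f j)) := by
  have hne : {m | ∃ f : Fin m → Fin n, StrictMono f ∧ StrictAnti (fun j => π (f j))}.Nonempty :=
    ⟨0, Fin.elim0, fun a => a.elim0, fun a => a.elim0⟩
  obtain ⟨f, hf, hπ⟩ := Nat.sSup_mem hne ⟨n, LDS_bddAbove π⟩
  exact ⟨fun j => f (Fin.castLE h j), fun a b hab => hf ((Fin.castLE_lt_castLE_iff h).2 hab),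
    fun a b hab => hπ ((Fin.castLE_lt_castLE_iff h).2 hab)⟩

lemma LDS_le {n : ℕ} (π : Equiv.Perm (Fin n)) : LDS π ≤ n :=
  csSup_le' (LDS_bddAbove π)

lemma one_le_LDS {n : ℕ} (hn : 0 < n) (π : Equiv.Perm (Fin n)) : 1 ≤ LDS π :=
  le_LDS (f := fun _ => ⟨0, hn⟩) (fun a b h => absurd h (by simp [Subsingleton.elim a b]))
    (fun a b h => absurd h (by simp [Subsingleton.elim a b]))

lemma LDS_le_LDS_insertPerm {N : ℕ} (v : Fin (N + 1)) (σ : Equiv.Perm (Fin N)) :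
    LDS σ ≤ LDS (insertPerm (Fin.last N) v σ) := by
  obtain ⟨f, hf, hσ⟩ := exists_of_le_LDS (le_refl (LDS σ))
  refine le_LDS (f := fun j => (f j).castSucc) (fun a b h => by simpa using hf h)
    (fun a b h => ?_)
  have h1 (j) : insertPerm (Fin.last N) v σ (f j).castSucc = v.succAbove (σ (f j)) := by
    rw [← Fin.succAbove_last, insertPerm_succAbove]
  simp only [h1]
  exact Fin.succAbove_lt_succAbove_iff.2 (hσ h)

/-- `σ` has a decreasing subsequence of length `j` all of whose values have at most `R` larger
values above them. -/
def HasHighDec {N : ℕ} (σ : Equiv.Perm (Fin N)) (j R : ℕ) : Prop :=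
  ∃ f : Fin j → Fin N, StrictMono f ∧ StrictAnti (fun k => σ (f k)) ∧
    ∀ k, N ≤ (σ (f k) : ℕ) + R + 1

lemma hasHighDec_zero {N : ℕ} (σ : Equiv.Perm (Fin N)) (R : ℕ) : HasHighDec σ 0 R :=
  ⟨Fin.elim0, fun a => a.elim0, fun a => a.elim0, fun a => a.elim0⟩

lemma HasHighDec.le_LDS {N j R : ℕ} {σ : Equiv.Perm (Fin N)} (h : HasHighDec σ j R) :
    j ≤ LDS σ := by
  obtain ⟨f, hf, hσ, -⟩ := h
  exact _root_.le_LDS hf hσ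

lemma insertPerm_last_castSucc {N : ℕ} (v : Fin (N + 1)) (σ : Equiv.Perm (Fin N)) (j : Fin N) :
    insertPerm (Fin.last N) v σ j.castSucc = v.succAbove (σ j) := by
  rw [← Fin.succAbove_last, insertPerm_succAbove]

lemma HasHighDec.insert {N j R : ℕ} {σ : Equiv.Perm (Fin N)} (h : HasHighDec σ j R)
    (v : Fin (N + 1)) : HasHighDec (insertPerm (Fin.last N) v σ) j (R + 1) := by
  obtain ⟨f, hf, hσ, hR⟩ := h
  refine ⟨fun k => (f k).castSucc, fun a b h => by simpa using hf h, fun a b h => ?_,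
    fun k => ?_⟩
  · simp only [insertPerm_last_castSucc]
    exact Fin.succAbove_lt_succAbove_iff.2 (hσ h)
  · rw [insertPerm_last_castSucc]
    have h1 : (σ (f k) : ℕ) ≤ v.succAbove (σ (f k)) := by
      unfold Fin.succAbove
      split_ifs <;> simp
    have := hR k
    omega

lemma HasHighDec.snoc {N j R s : ℕ} {σ : Equiv.Perm (Fin N)} (h : HasHighDec σ j R)
    (v : Fin (N + 1)) (h1 : R + 1 ≤ N - v) (h2 : N - v ≤ R + s) :
    HasHighDec (insertPerm (Fin.last N) v σ) (j + 1) (R + s) := by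
  obtain ⟨f, hf, hσ, hR⟩ := h
  have hv : ∀ k, v ≤ (σ (f k)).castSucc := fun k => by
    have := hR k
    simp only [Fin.le_def, Fin.val_castSucc]
    omega
  have hval : ∀ k, insertPerm (Fin.last N) v σ (f k).castSucc = (σ (f k)).succ := fun k => by
    rw [insertPerm_last_castSucc, Fin.succAbove_of_le_castSucc _ _ (hv k)]
  refine ⟨Fin.snoc (α := fun _ => Fin (N + 1)) (fun k => (f k).castSucc) (Fin.last N), ?_, ?_, ?_⟩
  · intro a b hab
    induction b using Fin.lastCases with
    | last =>
      induction a using Fin.lastCases with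
      | last => exact absurd hab (lt_irrefl _)
      | cast a => simp
    | cast b =>
      induction a using Fin.lastCases with
      | last => exact absurd hab (by simp [Fin.le_last])
      | cast a => simpa using hf (by simpa using hab)
  · intro a b hab
    induction b using Fin.lastCases with
    | last =>
      induction a using Fin.lastCases with
      | last => exact absurd hab (lt_irrefl _)
      | cast a =>
        simp only [Fin.snoc_last, Fin.snoc_castSucc, insertPerm_self, hval]
        exact lt_of_le_of_lt (hv a) Fin.castSucc_lt_succ
    | cast b =>
      induction a using Fin.lastCases with
      | last => exact absurd hab (by simp [Fin.le_last])
      | cast a =>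
        simp only [Fin.snoc_castSucc, hval]
        exact Fin.succ_lt_succ_iff.2 (hσ (by simpa using hab))
  · intro k
    induction k using Fin.lastCases with
    | last => simp only [Fin.snoc_last, insertPerm_self]; omega
    | cast k =>
      simp only [Fin.snoc_castSucc, hval, Fin.val_succ]
      have := hR k
      omega

lemma geom_sum_le {q : ℝ} (hq : 0 < q) (hq1 : q < 1) (k : ℕ) :
    ∑ j ∈ Finset.range k, q ^ j ≤ (1 - q)⁻¹ := by
  have h : 0 < 1 - q := by linarith
  rw [geom_sum_eq hq1.ne, ← neg_div_neg_eq, inv_eq_one_div]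
  have := pow_pos hq k
  rw [neg_sub, neg_sub]
  gcongr
  linarith

lemma insertAvg_ge {q : ℝ} (hq : 0 < q) (hq1 : q < 1) {F : (k : ℕ) → Equiv.Perm (Fin k) → ℝ}
    {N R s M : ℕ} {σ : Equiv.Perm (Fin N)} {A B : ℝ} (hAB : B ≤ A) (hM : R + s ≤ M) (hN : M ≤ N)
    (hB : ∀ v, B ≤ F (N + 1) (insertPerm (Fin.last N) v σ))
    (hA : ∀ v : Fin (N + 1), R + 1 ≤ N - v → N - v ≤ R + s →
      A ≤ F (N + 1) (insertPerm (Fin.last N) v σ)) :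
    ((1 - q) * s * q ^ M) * A + (1 - (1 - q) * s * q ^ M) * B ≤ insertAvg q F N σ := by
  have hr : 0 < 1 - q := by linarith
  set S := ∑ j ∈ Finset.range (N + 1), q ^ j with hS
  have hS0 : 0 < S := Finset.sum_pos (fun _ _ => pow_pos hq _) (by simp)
  have hS1 : (1 - q) * S ≤ 1 := by
    have := geom_sum_le hq hq1 (N + 1)
    calc (1 - q) * S ≤ (1 - q) * (1 - q)⁻¹ := by gcongr
      _ = 1 := mul_inv_cancel₀ hr.ne'
  set W : ℝ := ∑ v : Fin (N + 1), if R + 1 ≤ N - (v : ℕ) ∧ N - (v : ℕ) ≤ R + s then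
    q ^ (N - (v : ℕ)) else 0 with hW
  have hW1 : (s : ℝ) * q ^ M ≤ W := by
    have h1 : W = ∑ a ∈ Finset.range (N + 1), if R + 1 ≤ a ∧ a ≤ R + s then q ^ a else 0 := by
      rw [hW, Fin.sum_univ_eq_sum_range
        (fun k => if R + 1 ≤ N - k ∧ N - k ≤ R + s then q ^ (N - k) else 0),
        ← Finset.sum_range_reflect]
      refine Finset.sum_congr rfl fun k hk => ?_
      have := Finset.mem_range.1 hk
      have h2 : N - (N + 1 - 1 - k) = k := by omega
      rw [h2]
    rw [h1, ← Finset.sum_filter]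
    have h2 : (Finset.range (N + 1)).filter (fun a => R + 1 ≤ a ∧ a ≤ R + s)
        = Finset.Icc (R + 1) (R + s) := by
      ext a
      simp only [Finset.mem_filter, Finset.mem_range, Finset.mem_Icc]
      omega
    rw [h2]
    calc (s : ℝ) * q ^ M = ∑ _a ∈ Finset.Icc (R + 1) (R + s), q ^ M := by
          simp
      _ ≤ _ := by
          refine Finset.sum_le_sum fun a ha => ?_
          have := (Finset.mem_Icc.1 ha).2
          exact pow_le_pow_of_le_one hq.le hq1.le (by omega)
  have key : B * S + (A - B) * W ≤
      ∑ v : Fin (N + 1), q ^ (N - (v : ℕ)) * F (N + 1) (insertPerm (Fin.last N) v σ) := by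
    rw [hS, ← sum_pow_rev, hW, Finset.mul_sum, Finset.mul_sum, ← Finset.sum_add_distrib]
    refine Finset.sum_le_sum fun v _ => ?_
    have hp := pow_pos hq (N - (v : ℕ))
    split_ifs with h
    · have := hA v h.1 h.2
      nlinarith
    · have := hB v
      nlinarith
  rw [insertAvg, le_div_iff₀ hS0]
  refine le_trans ?_ key
  have h3 : (1 - q) * s * q ^ M * S ≤ W := by
    calc (1 - q) * s * q ^ M * S = (s * q ^ M) * ((1 - q) * S) := by ring
      _ ≤ (s * q ^ M) * 1 := by gcongr
      _ ≤ W := by simpa using hW1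
  nlinarith [mul_le_mul_of_nonneg_left h3 (sub_nonneg.2 hAB)]

/-- Probability that a binomial variable with parameters `t`, `p` is at least `k`. -/
noncomputable def binTail (p : ℝ) : ℕ → ℕ → ℝ
  | _, 0 => 1
  | 0, _ + 1 => 0
  | t + 1, k + 1 => p * binTail p t k + (1 - p) * binTail p t (k + 1)

@[simp] lemma binTail_zero_right (p : ℝ) (t : ℕ) : binTail p t 0 = 1 := by
  cases t <;> rfl

lemma binTail_bounds {p : ℝ} (h0 : 0 ≤ p) (h1 : p ≤ 1) (t : ℕ) :
    ∀ k, 0 ≤ binTail p t k ∧ binTail p t (k + 1) ≤ binTail p t k := by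
  induction t with
  | zero =>
    intro k
    cases k <;> simp [binTail]
  | succ t ih =>
    have hp : 0 ≤ 1 - p := by linarith
    intro k
    cases k with
    | zero =>
      simp only [binTail]
      have a := (ih 0).2
      simp only [binTail_zero_right] at a ⊢
      constructor
      · norm_num
      · nlinarith
    | succ k =>
      simp only [binTail]
      have a := ih k
      have b := ih (k + 1)
      constructor
      · have := mul_nonneg h0 a.1
        have := mul_nonneg hp b.1
        linarith
      · have := mul_le_mul_of_nonneg_left a.2 h0
        have := mul_le_mul_of_nonneg_left b.2 hp
        linarith

lemma binTail_le_one {p : ℝ} (h0 : 0 ≤ p) (h1 : p ≤ 1) (t k : ℕ) : binTail p t k ≤ 1 := by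
  induction k with
  | zero => simp
  | succ k ih => exact (binTail_bounds h0 h1 t k).2.trans ih

lemma binTail_le_succ {p : ℝ} (h0 : 0 ≤ p) (h1 : p ≤ 1) (t k : ℕ) :
    binTail p t k ≤ binTail p (t + 1) k := by
  cases k with
  | zero => simp
  | succ k =>
    simp only [binTail]
    have := (binTail_bounds h0 h1 t k).2
    nlinarith

lemma binTail_le_add {p : ℝ} (h0 : 0 ≤ p) (h1 : p ≤ 1) (t k u : ℕ) :
    binTail p t k ≤ binTail p (t + u) k := by
  induction u with
  | zero => rfl
  | succ u ih => exact ih.trans (binTail_le_succ h0 h1 (t + u) k)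

lemma binTail_chernoff {p : ℝ} (h0 : 0 ≤ p) (h1 : p ≤ 1) (t : ℕ) :
    ∀ k, 1 - 2 ^ k * (1 - p / 2) ^ t ≤ binTail p t k := by
  have hp : 0 ≤ 1 - p := by linarith
  have hp2 : 0 ≤ 1 - p / 2 := by linarith
  induction t with
  | zero =>
    intro k
    cases k with
    | zero => simp
    | succ k =>
      simp only [binTail, pow_zero, mul_one]
      have : (1 : ℝ) ≤ 2 ^ (k + 1) := one_le_pow₀ (by norm_num)
      linarith
  | succ t ih =>
    intro k
    cases k with
    | zero =>
      simp only [binTail_zero_right]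
      have := pow_nonneg hp2 (t + 1)
      linarith
    | succ k =>
      simp only [binTail]
      have a := mul_le_mul_of_nonneg_left (ih k) h0
      have b := mul_le_mul_of_nonneg_left (ih (k + 1)) hp
      refine le_trans (le_of_eq ?_) (add_le_add a b)
      ring

lemma binTail_add_ge {p : ℝ} (h0 : 0 ≤ p) (h1 : p ≤ 1) (t k u : ℕ) :
    (1 - (1 - p) ^ u) * binTail p t k ≤ binTail p (t + u) (k + 1) := by
  have hp : 0 ≤ 1 - p := by linarith
  induction u with
  | zero => simpa using (binTail_bounds h0 h1 t (k + 1)).1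
  | succ u ih =>
    rw [← add_assoc]
    simp only [binTail]
    have a := mul_le_mul_of_nonneg_left (binTail_le_add h0 h1 t k u) h0
    have b := mul_le_mul_of_nonneg_left ih hp
    refine le_trans (le_of_eq ?_) (add_le_add a b)
    ring

lemma pow_le_binTail {p : ℝ} (h0 : 0 ≤ p) (h1 : p ≤ 1) (m u : ℕ) :
    (1 - (1 - p) ^ u) ^ m ≤ binTail p (m * u) m := by
  have hq : 0 ≤ 1 - (1 - p) ^ u := by
    have : (1 - p) ^ u ≤ 1 := pow_le_one₀ (by linarith) (by linarith)
    linarith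
  induction m with
  | zero => simp
  | succ m ih =>
    rw [pow_succ', add_mul, one_mul]
    exact (mul_le_mul_of_nonneg_left ih hq).trans (binTail_add_ge h0 h1 _ _ _)

/-- Indicator of having a decreasing subsequence of length at least `m`. -/
noncomputable def ldsInd (m k : ℕ) (π : Equiv.Perm (Fin k)) : ℝ := if m ≤ LDS π then 1 else 0

lemma insertAvg_mono {q : ℝ} (hq : 0 < q) {F G : (k : ℕ) → Equiv.Perm (Fin k) → ℝ} {N : ℕ}
    {σ : Equiv.Perm (Fin N)} (h : ∀ v, F (N + 1) (insertPerm (Fin.last N) v σ) ≤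
      G (N + 1) (insertPerm (Fin.last N) v σ)) : insertAvg q F N σ ≤ insertAvg q G N σ := by
  have hS : 0 < ∑ j ∈ Finset.range (N + 1), q ^ j :=
    Finset.sum_pos (fun _ _ => pow_pos hq _) (by simp)
  rw [insertAvg, insertAvg]
  gcongr with v
  exact h v

lemma insertAvg_const {q : ℝ} (hq : 0 < q) (c : ℝ) (N : ℕ) (σ : Equiv.Perm (Fin N)) :
    insertAvg q (fun _ _ => c) N σ = c := by
  have hS : 0 < ∑ j ∈ Finset.range (N + 1), q ^ j :=
    Finset.sum_pos (fun _ _ => pow_pos hq _) (by simp)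
  rw [insertAvg, ← Finset.sum_mul, sum_pow_rev]
  field_simp

lemma iterate_insertAvg_ldsInd_eq_one {q : ℝ} (hq : 0 < q) (m t : ℕ) :
    ∀ (N : ℕ) (σ : Equiv.Perm (Fin N)), m ≤ LDS σ → 1 ≤ (insertAvg q)^[t] (ldsInd m) N σ := by
  induction t with
  | zero => intro N σ h; simp [ldsInd, h]
  | succ t ih =>
    intro N σ h
    rw [Function.iterate_succ_apply']
    calc (1 : ℝ) = insertAvg q (fun _ _ => 1) N σ := (insertAvg_const hq 1 N σ).symm
      _ ≤ _ := insertAvg_mono hq fun v => ih _ _ (h.trans (LDS_le_LDS_insertPerm v σ))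

lemma binTail_le_iterate {q : ℝ} (hq : 0 < q) (hq1 : q < 1) {m s M : ℕ}
    (hp : (1 - q) * s * q ^ M ≤ 1) (t : ℕ) :
    ∀ (k j R N : ℕ) (σ : Equiv.Perm (Fin N)), j + k = m → HasHighDec σ j R →
      R + t + s * k ≤ M → M ≤ N →
      binTail ((1 - q) * s * q ^ M) t k ≤ (insertAvg q)^[t] (ldsInd m) N σ := by
  have hr : 0 < 1 - q := by linarith
  have hp0 : 0 ≤ (1 - q) * s * q ^ M := by positivity
  induction t with
  | zero =>
    intro k j R N σ hjk h _ _
    cases k with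
    | zero =>
      rw [binTail_zero_right]
      exact iterate_insertAvg_ldsInd_eq_one hq m 0 N σ (by have := h.le_LDS; omega)
    | succ k =>
      simp only [binTail, Function.iterate_zero, id, ldsInd]
      split_ifs <;> norm_num
  | succ t ih =>
    intro k j R N σ hjk h hR hN
    cases k with
    | zero =>
      rw [binTail_zero_right]
      exact iterate_insertAvg_ldsInd_eq_one hq m _ N σ (by have := h.le_LDS; omega)
    | succ k =>
      rw [Function.iterate_succ_apply']
      simp only [binTail]
      rw [mul_add] at hR
      refine insertAvg_ge (R := R) hq hq1 (binTail_bounds hp0 hp t k).2 (by omega) hN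
        (fun v => ?_) (fun v h1 h2 => ?_)
      · exact ih (k + 1) j (R + 1) _ _ hjk (h.insert v) (by rw [mul_add]; omega) (by omega)
      · exact ih k (j + 1) (R + s) _ _ (by omega) (h.snoc v h1 h2) (by omega) (by omega)

lemma window_prob_le_one {q : ℝ} (hq : 0 < q) (hq1 : q < 1) {s M : ℕ} (h : s ≤ M) :
    (1 - q) * s * q ^ M ≤ 1 := by
  have hr : 0 < 1 - q := by linarith
  have h1 : (s : ℝ) * q ^ M ≤ ∑ k ∈ Finset.range s, q ^ k := by
    calc (s : ℝ) * q ^ M = ∑ _k ∈ Finset.range s, q ^ M := by simp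
      _ ≤ _ := Finset.sum_le_sum fun k hk =>
        pow_le_pow_of_le_one hq.le hq1.le (by have := Finset.mem_range.1 hk; omega)
  calc (1 - q) * s * q ^ M = (1 - q) * (s * q ^ M) := by ring
    _ ≤ (1 - q) * (1 - q)⁻¹ := by
        have := h1.trans (geom_sum_le hq hq1 s)
        gcongr
    _ = 1 := mul_inv_cancel₀ hr.ne'

lemma mallowsExp_ldsInd_le {n m : ℕ} {q : ℝ} (hq : 0 < q) :
    m * mallowsExp n q (ldsInd m n) ≤ mallowsExp n q (fun π => (LDS π : ℝ)) := by
  have h : (m : ℝ) * mallowsExp n q (ldsInd m n) =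
      mallowsExp n q (fun π => m * ldsInd m n π) := by
    rw [mallowsExp, mallowsExp, Finset.mul_sum]
    exact Finset.sum_congr rfl fun π _ => by ring
  rw [h]
  refine mallowsExp_mono hq fun π => ?_
  rw [ldsInd]
  split_ifs with h
  · simpa using h
  · simp

lemma one_le_mallowsExp_LDS {n : ℕ} (hn : 0 < n) {q : ℝ} (hq : 0 < q) :
    1 ≤ mallowsExp n q (fun π => (LDS π : ℝ)) := by
  calc (1 : ℝ) = mallowsExp n q (fun _ => 1) := (mallowsExp_const n hq 1).symm
    _ ≤ _ := mallowsExp_mono hq fun π => by exact_mod_cast one_le_LDS hn π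

lemma binTail_le_mallowsExp {q : ℝ} (hq : 0 < q) (hq1 : q < 1) {m s M t n : ℕ} (hs : s ≤ M)
    (hM : t + s * m ≤ M) (hn : M + t ≤ n) :
    m * binTail ((1 - q) * s * q ^ M) t m ≤ mallowsExp n q (fun π => (LDS π : ℝ)) := by
  refine le_trans ?_ (mallowsExp_ldsInd_le (m := m) hq)
  gcongr
  obtain ⟨N, rfl⟩ : ∃ N, n = N + t := ⟨n - t, by omega⟩
  rw [mallowsExp_add N t hq (ldsInd m)]
  calc _ = mallowsExp N q (fun _ => binTail ((1 - q) * s * q ^ M) t m) :=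
        (mallowsExp_const N hq _).symm
    _ ≤ _ := mallowsExp_mono hq fun σ =>
        binTail_le_iterate hq hq1 (window_prob_le_one hq hq1 hs) t m 0 0 N σ (by simp)
          (hasHighDec_zero σ 0) (by omega) (by omega)

lemma mallowsExp_ldsInd_blocks {q : ℝ} (hq : 0 < q) (hq1 : q < 1) {m s M t : ℕ} (hs : s ≤ M)
    (hM : t + s * m ≤ M) (b : ℕ) {N : ℕ} (hN : M ≤ N) :
    1 - (1 - binTail ((1 - q) * s * q ^ M) t m) ^ b ≤
      mallowsExp (N + b * t) q (ldsInd m (N + b * t)) := by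
  have hr : 0 < 1 - q := by linarith
  have hp0 : 0 ≤ (1 - q) * s * q ^ M := by positivity
  have hp1 := window_prob_le_one hq hq1 hs
  set β := binTail ((1 - q) * s * q ^ M) t m with hβ
  have hβ1 : β ≤ 1 := binTail_le_one hp0 hp1 t m
  induction b with
  | zero =>
    simp only [pow_zero, sub_self]
    calc (0 : ℝ) = mallowsExp _ q (fun _ => 0) := (mallowsExp_const _ hq 0).symm
      _ ≤ _ := mallowsExp_mono hq fun σ => by unfold ldsInd; split_ifs <;> norm_num
  | succ b ih =>
    have h1 : N + (b + 1) * t = (N + b * t) + t := by ring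
    rw [h1, mallowsExp_add _ t hq (ldsInd m)]
    have h2 : mallowsExp (N + b * t) q (fun σ => β + (1 - β) * ldsInd m _ σ) =
        β + (1 - β) * mallowsExp (N + b * t) q (ldsInd m _) := by
      have hc : mallowsExp (N + b * t) q (fun _ => β) = β := mallowsExp_const _ hq β
      refine Eq.trans ?_ (congrArg (· + (1 - β) * mallowsExp (N + b * t) q (ldsInd m _)) hc)
      rw [mallowsExp, mallowsExp, mallowsExp, Finset.mul_sum, ← Finset.sum_add_distrib]
      exact Finset.sum_congr rfl fun π _ => by ring
    calc 1 - (1 - β) ^ (b + 1) = β + (1 - β) * (1 - (1 - β) ^ b) := by ring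
      _ ≤ β + (1 - β) * mallowsExp (N + b * t) q (ldsInd m _) := by
          have : 0 ≤ 1 - β := by linarith
          gcongr
      _ = _ := h2.symm
      _ ≤ _ := mallowsExp_mono hq fun σ => ?_
    rw [ldsInd]
    split_ifs with h
    · have := iterate_insertAvg_ldsInd_eq_one hq m t _ σ h
      linarith
    · have := binTail_le_iterate (m := m) hq hq1 hp1 t m 0 0 _ σ (by simp)
          (hasHighDec_zero σ 0) (by omega) (by nlinarith)
      linarith

/-- Lower bound on the expected LDS from `b` independent blocks of `m * u` positions each. -/
lemma half_le_mallowsExp_LDS {q : ℝ} (hq : 0 < q) (hq1 : q < 1) {m u b n : ℕ} (hm : 1 ≤ m)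
    (hn : 2 * (m * u) + b * (m * u) ≤ n)
    (hb : 1 ≤ b * (1 - (1 - (1 - q) * u * q ^ (2 * (m * u))) ^ u) ^ m) :
    (m : ℝ) / 2 ≤ mallowsExp n q (fun π => (LDS π : ℝ)) := by
  have hr : 0 < 1 - q := by linarith
  have hp0 : 0 ≤ (1 - q) * u * q ^ (2 * (m * u)) := by positivity
  have hs : u ≤ 2 * (m * u) := by nlinarith
  have hp1 := window_prob_le_one hq hq1 hs
  have h1 := pow_le_binTail hp0 hp1 m u
  obtain ⟨N, rfl⟩ : ∃ N, n = N + b * (m * u) := ⟨n - b * (m * u), by omega⟩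
  have h2 := mallowsExp_ldsInd_blocks hq hq1 (m := m) (t := m * u) hs
    (by rw [mul_comm u m]; omega) b (N := N) (by omega)
  set β := binTail ((1 - q) * u * q ^ (2 * (m * u))) (m * u) m with hβ
  have h3 : (1 : ℝ) ≤ b * β := hb.trans (by gcongr)
  have hβ1 : β ≤ 1 := binTail_le_one hp0 hp1 _ m
  have h4 : (1 - β) ^ b ≤ 1 / 2 := by
    calc (1 - β) ^ b ≤ (Real.exp (-β)) ^ b := by
          have := Real.add_one_le_exp (-β)
          gcongr
          linarith
      _ = Real.exp (-(b * β)) := by rw [← Real.exp_nat_mul]; ring_nf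
      _ ≤ Real.exp (-1) := Real.exp_le_exp.2 (by linarith)
      _ ≤ 1 / 2 := by
          rw [Real.exp_neg, inv_le_comm₀ (Real.exp_pos 1) (by norm_num)]
          have := Real.add_one_le_exp (1 : ℝ)
          norm_num at this ⊢
          linarith
  refine le_trans ?_ (mallowsExp_ldsInd_le (m := m) hq)
  have h5 : (1 : ℝ) / 2 ≤ mallowsExp (N + b * (m * u)) q (ldsInd m _) := by linarith
  have : (0 : ℝ) ≤ m := by positivity
  nlinarith

lemma natAbs_le_cross {N : ℕ} (i v : Fin (N + 1)) (σ : Equiv.Perm (Fin N)) :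
    ((i : ℤ) - v).natAbs ≤
      (univ.filter fun j : Fin N => j.castSucc < i ∧ v ≤ (σ j).castSucc).card +
        (univ.filter fun j : Fin N => i ≤ j.castSucc ∧ (σ j).castSucc < v).card := by
  have hcard : ∀ w : Fin (N + 1), (univ.filter fun j : Fin N => j.castSucc < w).card = w := by
    intro w
    have : (univ.filter fun j : Fin N => j.castSucc < w)
        = univ.filter fun j : Fin N => (j : ℕ) < w := by
      ext j; simp [Fin.lt_def]
    rw [this, Fin.card_filter_val_lt]
    omega
  have hi := hcard i
  have hv : (univ.filter fun j : Fin N => (σ j).castSucc < v).card = v := by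
    rw [← hcard v]
    refine Finset.card_bij (fun j _ => σ j) ?_ ?_ ?_
    · intro j hj
      simpa using hj
    · intro a _ b _ h
      exact σ.injective h
    · intro b hb
      exact ⟨σ.symm b, by simpa using hb, by simp⟩
  rw [← Finset.card_filter_add_card_filter_not (fun j : Fin N => (σ j).castSucc < v)] at hi
  rw [← Finset.card_filter_add_card_filter_not (fun j : Fin N => j.castSucc < i)] at hv
  rw [Finset.filter_filter, Finset.filter_filter] at hi hv
  simp only [not_lt] at hi hv
  have e1 : (univ.filter fun j : Fin N => (σ j).castSucc < v ∧ j.castSucc < i) =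
      univ.filter fun j : Fin N => j.castSucc < i ∧ (σ j).castSucc < v := by
    ext j; simp [and_comm]
  have e2 : (univ.filter fun j : Fin N => (σ j).castSucc < v ∧ i ≤ j.castSucc) =
      univ.filter fun j : Fin N => i ≤ j.castSucc ∧ (σ j).castSucc < v := by
    ext j; simp [and_comm]
  rw [e1, e2] at hv
  omega

/-- Weight of the permutations with a prescribed decreasing pattern. -/
lemma sum_prescribed_le {x : ℝ} (hx : 0 < x) (hx1 : x ≤ 1) (n m : ℕ) :
    ∀ (I V : Fin m → Fin (n + m)), StrictMono I → StrictAnti V →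
      ∑ π : Equiv.Perm (Fin (n + m)),
        (if ∀ k, π (I k) = V k then (x ^ 4) ^ mallowsInv π else 0) ≤
      x ^ (∑ k, ((I k : ℤ) - V k).natAbs + m * (m - 1)) * mallowsZ n (x ^ 4) := by
  induction m with
  | zero =>
    intro I V _ _
    simp [mallowsZ]
  | succ m ih =>
    intro I V hI hV
    set i : Fin (n + m + 1) := I (Fin.last m) with hi
    set v : Fin (n + m + 1) := V (Fin.last m) with hv
    have hIi : ∀ k : Fin m, (I k.castSucc : ℕ) < i := fun k => hI (Fin.castSucc_lt_last k)
    have hVv : ∀ k : Fin m, (v : ℕ) < V k.castSucc := fun k => hV (Fin.castSucc_lt_last k)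
    set I' : Fin m → Fin (n + m) := fun k => ⟨I k.castSucc, by
      have := hIi k; have := i.2; omega⟩
    set V' : Fin m → Fin (n + m) := fun k => ⟨V k.castSucc - 1, by
      have := hVv k; have := (V k.castSucc).2; omega⟩
    have vI : ∀ k, (I' k : ℕ) = I k.castSucc := fun _ => rfl
    have vV : ∀ k, (V' k : ℕ) = V k.castSucc - 1 := fun _ => rfl
    have eI : ∀ k : Fin m, I k.castSucc = i.succAbove (I' k) := fun k => by
      rw [Fin.succAbove_of_castSucc_lt _ _ (by simpa only [Fin.lt_def, Fin.val_castSucc, vI] using hIi k)]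
      ext; simp only [Fin.val_castSucc, vI]
    have eV : ∀ k : Fin m, V k.castSucc = v.succAbove (V' k) := fun k => by
      have := hVv k
      rw [Fin.succAbove_of_le_castSucc _ _ (by simp only [Fin.le_def, vV, Fin.val_castSucc]; omega)]
      ext; simp only [vV, Fin.val_succ]; omega
    have hI'm : StrictMono I' := fun a b hab => by
      have : I a.castSucc < I b.castSucc := hI (by simpa using hab)
      simpa only [Fin.lt_def, vI] using this
    have hV'a : StrictAnti V' := fun a b hab => by
      have h1 : V b.castSucc < V a.castSucc := hV (by simpa using hab)
      have h2 := hVv b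
      simp only [Fin.lt_def, vV] at h1 ⊢
      omega
    have hx4 : 0 < x ^ 4 := by positivity
    have step : ∀ σ : Equiv.Perm (Fin (n + m)),
        (if ∀ k, insertPerm i v σ (I k) = V k then (x ^ 4) ^ mallowsInv (insertPerm i v σ)
          else 0) ≤ x ^ (((i : ℤ) - v).natAbs + 3 * m) *
            (if ∀ k, σ (I' k) = V' k then (x ^ 4) ^ mallowsInv σ else 0) := by
      intro σ
      split_ifs with h1 h2 h2
      · have c1 := natAbs_le_cross i v σ
        have c2 : m ≤ (univ.filter fun j : Fin (n + m) =>
            j.castSucc < i ∧ v ≤ (σ j).castSucc).card := by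
          calc m = (univ.image I').card := by
                rw [Finset.card_image_of_injective _ hI'm.injective]; simp
            _ ≤ _ := by
                refine Finset.card_le_card fun j hj => ?_
                obtain ⟨k, -, rfl⟩ := Finset.mem_image.1 hj
                simp only [Finset.mem_filter, Finset.mem_univ, true_and, h2 k]
                have := hVv k
                constructor
                · simpa only [Fin.lt_def, Fin.val_castSucc, vI] using hIi k
                · simp only [Fin.le_def, vV, Fin.val_castSucc]; omega
        rw [mallowsInv_insertPerm, ← pow_mul, ← pow_mul, ← pow_add]
        refine pow_le_pow_of_le_one hx.le hx1 ?_
        omega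
      · exfalso
        apply h2
        intro k
        have := h1 k.castSucc
        rw [eI, eV, insertPerm_succAbove] at this
        exact Fin.succAbove_right_injective this
      · positivity
      · simp
    have hd : ∑ k : Fin m, ((I k.castSucc : ℤ) - V k.castSucc).natAbs ≤
        ∑ k : Fin m, ((I' k : ℤ) - V' k).natAbs + m := by
      calc _ ≤ ∑ k : Fin m, (((I' k : ℤ) - V' k).natAbs + 1) := by
            refine Finset.sum_le_sum fun k _ => ?_
            have := hVv k
            simp only [vI, vV]
            omega
        _ = _ := by simp [Finset.sum_add_distrib]
    have main : ∑ π : Equiv.Perm (Fin (n + m + 1)),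
        (if ∀ k, π (I k) = V k then (x ^ 4) ^ mallowsInv π else 0) ≤
        x ^ (((i : ℤ) - v).natAbs + 3 * m) *
          (x ^ (∑ k, ((I' k : ℤ) - V' k).natAbs + m * (m - 1)) * mallowsZ n (x ^ 4)) := by
      rw [sum_perm_succ i, Finset.sum_eq_single v]
      · calc _ ≤ ∑ σ : Equiv.Perm (Fin (n + m)), x ^ (((i : ℤ) - v).natAbs + 3 * m) *
            (if ∀ k, σ (I' k) = V' k then (x ^ 4) ^ mallowsInv σ else 0) :=
              Finset.sum_le_sum fun σ _ => step σ
          _ ≤ _ := by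
              rw [← Finset.mul_sum]
              have := ih I' V' hI'm hV'a
              gcongr
      · intro w _ hw
        refine Finset.sum_eq_zero fun σ _ => if_neg fun h => hw ?_
        have := h (Fin.last m)
        rw [← hi, insertPerm_self] at this
        exact this
      · simp
    refine main.trans ?_
    have hZ := mallowsZ_pos n hx4
    rw [← mul_assoc, ← pow_add]
    refine mul_le_mul_of_nonneg_right (pow_le_pow_of_le_one hx.le hx1 ?_) hZ.le
    rw [Fin.sum_univ_castSucc, ← hi, ← hv]
    have : (m + 1) * (m + 1 - 1) = m * (m - 1) + 2 * m := by
      cases m with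
      | zero => rfl
      | succ m => simp only [Nat.add_sub_cancel]; ring
    omega

lemma mallowsZ_add_ge {q : ℝ} (hq : 0 < q) (hq1 : q < 1) (n m : ℕ)
    (h : q ^ (n + 1) ≤ 1 / 2) :
    mallowsZ n q ≤ mallowsZ (n + m) q * (2 * (1 - q)) ^ m := by
  have hr : 0 < 1 - q := by linarith
  induction m with
  | zero => simp
  | succ m ih =>
    refine ih.trans ?_
    rw [← add_assoc, mallowsZ_succ, pow_succ]
    have hZ := mallowsZ_pos (n + m) hq
    have h1 : 1 ≤ (∑ k ∈ Finset.range (n + m + 1), q ^ k) * (2 * (1 - q)) := by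
      have h2 : (∑ k ∈ Finset.range (n + m + 1), q ^ k) * (1 - q) = 1 - q ^ (n + m + 1) :=
        geom_sum_mul_neg q _
      have h3 : q ^ (n + m + 1) ≤ q ^ (n + 1) := pow_le_pow_of_le_one hq.le hq1.le (by omega)
      nlinarith
    calc mallowsZ (n + m) q * (2 * (1 - q)) ^ m
        = mallowsZ (n + m) q * (2 * (1 - q)) ^ m * 1 := by ring
      _ ≤ mallowsZ (n + m) q * (2 * (1 - q)) ^ m *
          ((∑ k ∈ Finset.range (n + m + 1), q ^ k) * (2 * (1 - q))) := by gcongr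
      _ = _ := by ring

lemma sum_powersetCard_prod_le {ι : Type*} [Fintype ι] [DecidableEq ι] (g : ι → ℝ)
    (hg : ∀ i, 0 ≤ g i) {S z : ℝ} (hz : 0 < z) (hS : ∑ i, g i ≤ S) (m : ℕ) :
    ∑ s ∈ Finset.powersetCard m univ, ∏ i ∈ s, g i ≤ Real.exp (z * S) / z ^ m := by
  rw [le_div_iff₀ (by positivity), Finset.sum_mul]
  calc ∑ s ∈ Finset.powersetCard m univ, (∏ i ∈ s, g i) * z ^ m
      = ∑ s ∈ Finset.powersetCard m univ, ∏ i ∈ s, (z * g i) := by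
        refine Finset.sum_congr rfl fun s hs => ?_
        rw [Finset.prod_mul_distrib, Finset.prod_const, (Finset.mem_powersetCard.1 hs).2, mul_comm]
    _ ≤ ∑ s ∈ (univ : Finset ι).powerset, ∏ i ∈ s, (z * g i) := by
        refine Finset.sum_le_sum_of_subset_of_nonneg
          (fun s hs => Finset.mem_powerset.2 (Finset.mem_powersetCard.1 hs).1) fun s _ _ => ?_
        exact Finset.prod_nonneg fun i _ => mul_nonneg hz.le (hg i)
    _ = ∏ i, (1 + z * g i) := (Finset.prod_one_add _).symm
    _ ≤ ∏ i, Real.exp (z * g i) := by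
        refine Finset.prod_le_prod (fun i _ => ?_) fun i _ => ?_
        · have := mul_nonneg hz.le (hg i); linarith
        · have := Real.add_one_le_exp (z * g i); linarith
    _ = Real.exp (z * ∑ i, g i) := by rw [← Real.exp_sum, Finset.mul_sum]
    _ ≤ _ := by gcongr

lemma sum_pow_dist_le {x : ℝ} (hx : 0 < x) (hx1 : x < 1) (n c : ℕ) :
    ∑ j : Fin n, x ^ ((j : ℤ) - c).natAbs ≤ 2 / (1 - x) := by
  have hr : 0 < 1 - x := by linarith
  rw [Fin.sum_univ_eq_sum_range (fun j => x ^ ((j : ℤ) - c).natAbs) n]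
  calc ∑ j ∈ Finset.range n, x ^ ((j : ℤ) - c).natAbs
      ≤ ∑ j ∈ Finset.range (c + n), x ^ ((j : ℤ) - c).natAbs :=
        Finset.sum_le_sum_of_subset_of_nonneg (Finset.range_mono (by omega))
          fun _ _ _ => by positivity
    _ = ∑ j ∈ Finset.range c, x ^ ((j : ℤ) - c).natAbs +
        ∑ j ∈ Finset.range n, x ^ (((c + j : ℕ) : ℤ) - c).natAbs := Finset.sum_range_add _ _ _
    _ ≤ (1 - x)⁻¹ + (1 - x)⁻¹ := by
        gcongr
        · rw [← Finset.sum_range_reflect]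
          refine le_trans (Finset.sum_le_sum fun j hj => ?_) (geom_sum_le hx hx1 c)
          have := Finset.mem_range.1 hj
          exact pow_le_pow_of_le_one hx.le hx1.le (by omega)
        · refine le_trans (le_of_eq (Finset.sum_congr rfl fun j _ => ?_)) (geom_sum_le hx hx1 n)
          congr 1
          omega
    _ = 2 / (1 - x) := by rw [← two_mul, div_eq_mul_inv]

lemma exists_separating_point {N m : ℕ} (hN : 0 < N) {I V : Fin m → Fin N} (hI : StrictMono I)
    (hV : StrictAnti V) : ∃ c : Fin N, ∀ k,
      ((I k : ℤ) - V k).natAbs = ((I k : ℤ) - (c : ℕ)).natAbs + ((V k : ℤ) - (c : ℕ)).natAbs := by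
  have hlt : (univ.sup fun k => min (I k : ℕ) (V k)) < N := by
    rw [Finset.sup_lt_iff (by simpa using hN)]
    exact fun k _ => (min_le_left _ _).trans_lt (I k).2
  refine ⟨⟨_, hlt⟩, fun l => ?_⟩
  have h1 : min (I l : ℕ) (V l) ≤ univ.sup fun k => min (I k : ℕ) (V k) :=
    Finset.le_sup (f := fun k => min (I k : ℕ) (V k)) (Finset.mem_univ l)
  have h2 : (univ.sup fun k => min (I k : ℕ) (V k)) ≤ max (I l : ℕ) (V l) := by
    refine Finset.sup_le fun k _ => ?_
    rcases le_or_gt k l with h | h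
    · have : (I k : ℕ) ≤ I l := hI.monotone h
      omega
    · have : (V k : ℕ) < V l := hV h
      omega
  simp only
  omega

lemma prod_orderEmbOfFin {N m : ℕ} (s : Finset (Fin N)) (h : s.card = m) (g : Fin N → ℝ) :
    ∏ k, g (s.orderEmbOfFin h k) = ∏ i ∈ s, g i := by
  conv_rhs => rw [← Finset.image_orderEmbOfFin_univ s h]
  rw [Finset.prod_image fun a _ b _ hab => (s.orderEmbOfFin h).injective hab]

lemma ldsInd_le_sum {N m : ℕ} (π : Equiv.Perm (Fin N)) :
    ldsInd m N π ≤ ∑ s : {s : Finset (Fin N) // s.card = m},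
      ∑ t : {t : Finset (Fin N) // t.card = m},
        if ∀ k, π (s.1.orderEmbOfFin s.2 k) = t.1.orderEmbOfFin t.2 (Fin.rev k) then 1 else 0 := by
  have hnn : ∀ s t : {s : Finset (Fin N) // s.card = m}, (0 : ℝ) ≤
      if ∀ k, π (s.1.orderEmbOfFin s.2 k) = t.1.orderEmbOfFin t.2 (Fin.rev k) then 1 else 0 := by
    intro s t
    split_ifs <;> norm_num
  rw [ldsInd]
  split_ifs with h
  · obtain ⟨f, hf, hπ⟩ := exists_of_le_LDS h
    have hs : (univ.image f).card = m := by
      rw [Finset.card_image_of_injective _ hf.injective]; simp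
    have ht : (univ.image fun j => π (f j)).card = m := by
      rw [Finset.card_image_of_injective _ hπ.injective]; simp
    have e1 : f = (univ.image f).orderEmbOfFin hs :=
      Finset.orderEmbOfFin_unique hs (fun x => Finset.mem_image_of_mem _ (Finset.mem_univ _)) hf
    have e2 : (fun k => π (f (Fin.rev k))) = (univ.image fun j => π (f j)).orderEmbOfFin ht :=
      Finset.orderEmbOfFin_unique ht
        (fun x => Finset.mem_image.2 ⟨Fin.rev x, Finset.mem_univ _, rfl⟩)
        fun a b hab => hπ (Fin.rev_lt_rev.2 hab)
    refine le_trans ?_ (Finset.single_le_sum (fun s _ => Finset.sum_nonneg fun t _ => hnn s t)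
      (Finset.mem_univ ⟨_, hs⟩))
    refine le_trans ?_ (Finset.single_le_sum (fun t _ => hnn ⟨_, hs⟩ t)
      (Finset.mem_univ ⟨_, ht⟩))
    rw [if_pos]
    intro k
    rw [← e1, ← e2]
    simp only [Fin.rev_rev]
  · exact Finset.sum_nonneg fun s _ => Finset.sum_nonneg fun t _ => hnn s t

lemma sum_subtype_powersetCard_le {N m : ℕ} {x S z : ℝ} (hx : 0 < x) (hx1 : x < 1) (hz : 0 < z)
    (hS : 2 / (1 - x) ≤ S) (c : ℕ) :
    ∑ s : {s : Finset (Fin N) // s.card = m}, ∏ i ∈ s.1, x ^ ((i : ℤ) - c).natAbs ≤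
      Real.exp (z * S) / z ^ m := by
  refine le_trans (le_of_eq ?_) (sum_powersetCard_prod_le
    (fun i : Fin N => x ^ ((i : ℤ) - c).natAbs) (fun i => by positivity) hz
    ((sum_pow_dist_le hx hx1 N c).trans hS) m)
  exact (Finset.sum_subtype (Finset.powersetCard m univ) (fun s => by simp)
    (fun s : Finset (Fin N) => ∏ i ∈ s, x ^ ((i : ℤ) - c).natAbs)).symm

lemma sum_pairs_le {N m : ℕ} (hN : 0 < N) {x S z : ℝ} (hx : 0 < x) (hx1 : x < 1) (hz : 0 < z)
    (hS : 2 / (1 - x) ≤ S) :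
    ∑ s : {s : Finset (Fin N) // s.card = m}, ∑ t : {t : Finset (Fin N) // t.card = m},
      x ^ (∑ k, ((s.1.orderEmbOfFin s.2 k : ℤ) -
        t.1.orderEmbOfFin t.2 (Fin.rev k)).natAbs) ≤ N * (Real.exp (z * S) / z ^ m) ^ 2 := by
  calc _ ≤ ∑ s : {s : Finset (Fin N) // s.card = m}, ∑ t : {t : Finset (Fin N) // t.card = m},
        ∑ c : Fin N, (∏ i ∈ s.1, x ^ ((i : ℤ) - (c : ℕ)).natAbs) *
          ∏ i ∈ t.1, x ^ ((i : ℤ) - (c : ℕ)).natAbs := by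
        refine Finset.sum_le_sum fun s _ => Finset.sum_le_sum fun t _ => ?_
        obtain ⟨c, hc⟩ := exists_separating_point hN (s.1.orderEmbOfFin s.2).strictMono
          (V := fun k => t.1.orderEmbOfFin t.2 (Fin.rev k))
          (fun a b hab => (t.1.orderEmbOfFin t.2).strictMono (Fin.rev_lt_rev.2 hab))
        refine le_trans (le_of_eq ?_) (Finset.single_le_sum (fun c _ => by positivity)
          (Finset.mem_univ c))
        rw [← prod_orderEmbOfFin s.1 s.2, ← prod_orderEmbOfFin t.1 t.2,
          ← Equiv.prod_comp Fin.revPerm (fun k => x ^ ((t.1.orderEmbOfFin t.2 k : ℤ) -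
            (c : ℕ)).natAbs), Finset.prod_pow_eq_pow_sum, Finset.prod_pow_eq_pow_sum, ← pow_add,
          ← Finset.sum_add_distrib]
        congr 1
        exact Finset.sum_congr rfl fun k _ => hc k
    _ = ∑ c : Fin N, (∑ s : {s : Finset (Fin N) // s.card = m},
          ∏ i ∈ s.1, x ^ ((i : ℤ) - (c : ℕ)).natAbs) *
        ∑ t : {t : Finset (Fin N) // t.card = m}, ∏ i ∈ t.1, x ^ ((i : ℤ) - (c : ℕ)).natAbs := by
        symm
        simp_rw [Finset.sum_mul_sum]
        rw [Finset.sum_comm]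
        exact Finset.sum_congr rfl fun s _ => Finset.sum_comm
    _ ≤ ∑ _c : Fin N, (Real.exp (z * S) / z ^ m) ^ 2 := by
        refine Finset.sum_le_sum fun c _ => ?_
        have := sum_subtype_powersetCard_le (N := N) (m := m) hx hx1 hz hS c
        rw [sq]
        gcongr
    _ = _ := by simp

lemma mallowsExp_ldsInd_le_aux {n m : ℕ} (hN : 0 < n + m) {x S z : ℝ} (hx : 0 < x) (hx1 : x < 1)
    (hz : 0 < z) (hS : 2 / (1 - x) ≤ S) (hn : (x ^ 4) ^ (n + 1) ≤ 1 / 2) :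
    mallowsExp (n + m) (x ^ 4) (ldsInd m (n + m)) ≤
      (n + m : ℕ) * (Real.exp (z * S) / z ^ m) ^ 2 * x ^ (m * (m - 1)) *
        (2 * (1 - x ^ 4)) ^ m := by
  have hq : 0 < x ^ 4 := by positivity
  have hq1 : x ^ 4 < 1 := pow_lt_one₀ hx.le hx1 (by norm_num)
  rw [mallowsExp_eq, div_le_iff₀ (mallowsZ_pos _ hq)]
  calc ∑ π, (x ^ 4) ^ mallowsInv π * ldsInd m (n + m) π
      ≤ ∑ π : Equiv.Perm (Fin (n + m)), ∑ s : {s : Finset (Fin (n + m)) // s.card = m},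
        ∑ t : {t : Finset (Fin (n + m)) // t.card = m},
        if ∀ k, π (s.1.orderEmbOfFin s.2 k) = t.1.orderEmbOfFin t.2 (Fin.rev k) then
          (x ^ 4) ^ mallowsInv π else 0 := by
        refine Finset.sum_le_sum fun π _ => ?_
        refine (mul_le_mul_of_nonneg_left (ldsInd_le_sum π) (by positivity)).trans (le_of_eq ?_)
        simp_rw [Finset.mul_sum, mul_ite, mul_one, mul_zero]
    _ = ∑ s : {s : Finset (Fin (n + m)) // s.card = m},
        ∑ t : {t : Finset (Fin (n + m)) // t.card = m}, ∑ π : Equiv.Perm (Fin (n + m)),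
        if ∀ k, π (s.1.orderEmbOfFin s.2 k) = t.1.orderEmbOfFin t.2 (Fin.rev k) then
          (x ^ 4) ^ mallowsInv π else 0 := by
        rw [Finset.sum_comm]
        exact Finset.sum_congr rfl fun s _ => Finset.sum_comm
    _ ≤ ∑ s : {s : Finset (Fin (n + m)) // s.card = m},
        ∑ t : {t : Finset (Fin (n + m)) // t.card = m},
        x ^ (∑ k, ((s.1.orderEmbOfFin s.2 k : ℤ) -
          t.1.orderEmbOfFin t.2 (Fin.rev k)).natAbs) *
          (x ^ (m * (m - 1)) * mallowsZ n (x ^ 4)) := by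
        refine Finset.sum_le_sum fun s _ => Finset.sum_le_sum fun t _ => ?_
        have := sum_prescribed_le hx hx1.le n m _
          (fun k => t.1.orderEmbOfFin t.2 (Fin.rev k)) (s.1.orderEmbOfFin s.2).strictMono
          (fun a b hab => (t.1.orderEmbOfFin t.2).strictMono (Fin.rev_lt_rev.2 hab))
        rwa [pow_add, mul_assoc] at this
    _ = (∑ s : {s : Finset (Fin (n + m)) // s.card = m},
        ∑ t : {t : Finset (Fin (n + m)) // t.card = m},
        x ^ (∑ k, ((s.1.orderEmbOfFin s.2 k : ℤ) -
          t.1.orderEmbOfFin t.2 (Fin.rev k)).natAbs)) *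
          (x ^ (m * (m - 1)) * mallowsZ n (x ^ 4)) := by
        simp_rw [Finset.sum_mul]
    _ ≤ ((n + m : ℕ) * (Real.exp (z * S) / z ^ m) ^ 2) *
        (x ^ (m * (m - 1)) * (mallowsZ (n + m) (x ^ 4) * (2 * (1 - x ^ 4)) ^ m)) := by
        have h1 := sum_pairs_le (m := m) hN hx hx1 hz hS
        have h2 := mallowsZ_add_ge hq hq1 n m hn
        have h3 := mallowsZ_pos n hq
        gcongr
    _ = _ := by ring

/-- First-moment bound on the probability of a long decreasing subsequence. -/
lemma mallowsExp_ldsInd_upper {N m : ℕ} (hm : 1 ≤ m) (hmN : 2 * m ≤ N) {x : ℝ} (hx : 0 < x)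
    (hx1 : x < 1) (hN : 4 ≤ N * (1 - x ^ 4)) :
    mallowsExp N (x ^ 4) (ldsInd m N) ≤
      N * x ^ (m * (m - 1)) * (950 / ((1 - x ^ 4) * m ^ 2)) ^ m := by
  obtain ⟨n, rfl⟩ : ∃ n, N = n + m := ⟨N - m, by omega⟩
  have hq1 : x ^ 4 < 1 := pow_lt_one₀ hx.le hx1 (by norm_num)
  set r := 1 - x ^ 4 with hr
  have hr0 : 0 < r := by linarith
  have hm0 : (0 : ℝ) < m := by exact_mod_cast hm
  have hS : 2 / (1 - x) ≤ 8 / r := by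
    have h1 : 0 < 1 - x := by linarith
    rw [div_le_div_iff₀ h1 hr0, hr]
    have h2 : x ^ 2 ≤ 1 := pow_le_one₀ hx.le hx1.le
    have : (1 - x ^ 4) = (1 - x) * ((1 + x) * (1 + x ^ 2)) := by ring
    have h3 : (1 + x) * (1 + x ^ 2) ≤ 4 := by nlinarith
    rw [this]
    nlinarith
  have hn : (x ^ 4) ^ (n + 1) ≤ 1 / 2 := by
    have h1 : x ^ 4 ≤ Real.exp (-r) := by
      have := Real.add_one_le_exp (-r); linarith
    have hnn : ((n + m : ℕ) : ℝ) ≤ 2 * (n + 1 : ℕ) := by exact_mod_cast (by omega)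
    calc (x ^ 4) ^ (n + 1) ≤ Real.exp (-r) ^ (n + 1) := by gcongr
      _ = Real.exp ((n + 1 : ℕ) * -r) := (Real.exp_nat_mul _ _).symm
      _ ≤ Real.exp (-1) := Real.exp_le_exp.2 (by nlinarith)
      _ ≤ 1 / 2 := by
          rw [Real.exp_neg, inv_le_comm₀ (Real.exp_pos 1) (by norm_num)]
          have := Real.add_one_le_exp (1 : ℝ)
          norm_num at this ⊢
          linarith
  have hz : 0 < m * r / 8 := by positivity
  have key := mallowsExp_ldsInd_le_aux (n := n) (m := m) (by omega) hx hx1 hz hS hn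
  refine key.trans ?_
  have e1 : m * r / 8 * (8 / r) = (m : ℝ) := by field_simp
  have e2 : (Real.exp (m * r / 8 * (8 / r)) / (m * r / 8) ^ m) ^ 2 * (2 * r) ^ m =
      (128 * (Real.exp 1) ^ 2 / (r * m ^ 2)) ^ m := by
    have : Real.exp (m : ℝ) = Real.exp 1 ^ m := by rw [← Real.exp_nat_mul, mul_one]
    rw [e1, this, ← div_pow, ← pow_mul, mul_comm m 2, pow_mul, ← mul_pow]
    congr 1
    field_simp
    norm_num
  have e3 : 128 * (Real.exp 1) ^ 2 ≤ 950 := by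
    have := Real.exp_one_lt_d9
    have h0 := Real.exp_pos 1
    nlinarith
  calc _ = ((n + m : ℕ) : ℝ) * x ^ (m * (m - 1)) *
        ((Real.exp (m * r / 8 * (8 / r)) / (m * r / 8) ^ m) ^ 2 * (2 * r) ^ m) := by ring
    _ ≤ _ := by
        rw [e2]
        gcongr

/-- Upper bound on the expected LDS once the first-moment bound is small. -/
lemma mallowsExp_LDS_le {N m : ℕ} (hm : 1 ≤ m) {x : ℝ} (hx : 0 < x)
    (hx1 : x < 1) (hN : 4 ≤ N * (1 - x ^ 4))
    (h : (N : ℝ) ^ 2 * x ^ (m * (m - 1)) * (950 / ((1 - x ^ 4) * m ^ 2)) ^ m ≤ 1) :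
    mallowsExp N (x ^ 4) (fun π => (LDS π : ℝ)) ≤ 2 * m + 1 := by
  have hq : 0 < x ^ 4 := by positivity
  rcases le_or_gt (2 * m) N with hmN | hmN
  · have h1 := mallowsExp_ldsInd_upper hm hmN hx hx1 hN
    calc mallowsExp N (x ^ 4) (fun π => (LDS π : ℝ))
        ≤ mallowsExp N (x ^ 4) (fun π => (m : ℝ) + N * ldsInd m N π) := by
          refine mallowsExp_mono hq fun π => ?_
          rw [ldsInd]
          have h2 : (LDS π : ℝ) ≤ N := by exact_mod_cast LDS_le π
          split_ifs with h3
          · have : (0 : ℝ) ≤ m := by positivity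
            linarith
          · have : (LDS π : ℝ) ≤ m := by exact_mod_cast (not_le.1 h3).le
            linarith
      _ = mallowsExp N (x ^ 4) (fun _ => (m : ℝ)) + N * mallowsExp N (x ^ 4) (ldsInd m N) := by
          rw [mallowsExp, mallowsExp, mallowsExp, Finset.mul_sum, ← Finset.sum_add_distrib]
          exact Finset.sum_congr rfl fun π _ => by ring
      _ ≤ m + N * (N * x ^ (m * (m - 1)) * (950 / ((1 - x ^ 4) * m ^ 2)) ^ m) := by
          rw [mallowsExp_const N hq]
          gcongr
      _ = m + (N : ℝ) ^ 2 * x ^ (m * (m - 1)) * (950 / ((1 - x ^ 4) * m ^ 2)) ^ m := by ring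
      _ ≤ _ := by
          have : (0 : ℝ) ≤ m := by positivity
          linarith
  · calc mallowsExp N (x ^ 4) (fun π => (LDS π : ℝ)) ≤ mallowsExp N (x ^ 4) (fun _ => (N : ℝ)) :=
          mallowsExp_mono hq fun π => by exact_mod_cast LDS_le π
      _ = N := mallowsExp_const N hq _
      _ ≤ _ := by exact_mod_cast (by omega)

lemma mallowsExp_LDS_le_of_exp_le {n m : ℕ} (hm : 1 ≤ m) (hn : 1 ≤ n) {q d : ℝ} (hq : 0 < q)
    (hq1 : q < 1) (hN : 4 ≤ n * (1 - q)) (hd : 950 * Real.exp d ≤ (1 - q) * m ^ 2)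
    (hmd : 2 * Real.log n ≤ m * d) :
    mallowsExp n q (fun π => (LDS π : ℝ)) ≤ 2 * m + 1 := by
  have hm0 : (0 : ℝ) < m := by exact_mod_cast hm
  have hn0 : (0 : ℝ) < n := by exact_mod_cast hn
  have hr : 0 < 1 - q := by linarith
  have hx4 : Real.sqrt (Real.sqrt q) ^ 4 = q := by
    rw [show 4 = 2 * 2 from rfl, pow_mul, Real.sq_sqrt (Real.sqrt_nonneg q), Real.sq_sqrt hq.le]
  have hx0 : 0 < Real.sqrt (Real.sqrt q) := by positivity
  have hx1 : Real.sqrt (Real.sqrt q) < 1 := by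
    rw [Real.sqrt_lt' one_pos, one_pow, Real.sqrt_lt' one_pos, one_pow]; exact hq1
  have key := mallowsExp_LDS_le (N := n) hm hx0 hx1
  rw [hx4] at key
  refine key hN ?_
  have h1 : 950 / ((1 - q) * m ^ 2) ≤ Real.exp (-d) := by
    rw [div_le_iff₀ (by positivity), Real.exp_neg, inv_mul_eq_div, le_div_iff₀ (Real.exp_pos d)]
    exact hd
  have h2 : (950 / ((1 - q) * m ^ 2)) ^ m ≤ Real.exp (-(2 * Real.log n)) := by
    calc (950 / ((1 - q) * m ^ 2)) ^ m ≤ Real.exp (-d) ^ m := by gcongr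
      _ = Real.exp (-(m * d)) := by rw [← Real.exp_nat_mul]; ring_nf
      _ ≤ _ := Real.exp_le_exp.2 (by linarith)
  have h3 : Real.exp (-(2 * Real.log n)) = ((n : ℝ) ^ 2)⁻¹ := by
    rw [Real.exp_neg, show 2 * Real.log n = Real.log n + Real.log n by ring, Real.exp_add,
      Real.exp_log hn0, sq]
  rw [h3] at h2
  have h4 : Real.sqrt (Real.sqrt q) ^ (m * (m - 1)) ≤ 1 := pow_le_one₀ hx0.le hx1.le
  calc (n : ℝ) ^ 2 * Real.sqrt (Real.sqrt q) ^ (m * (m - 1)) * (950 / ((1 - q) * m ^ 2)) ^ m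
      ≤ (n : ℝ) ^ 2 * 1 * ((n : ℝ) ^ 2)⁻¹ := by gcongr
    _ = 1 := by field_simp

lemma mallowsExp_LDS_le_of_log_le {n m : ℕ} (hm : 2 ≤ m) (hn : 1 ≤ n) {q : ℝ} (hq : 0 < q)
    (hq1 : q < 1) (hN : 4 ≤ n * (1 - q)) (hd : 950 ≤ (1 - q) * m ^ 2)
    (hmd : 16 * Real.log n ≤ Real.log (1 / q) * m ^ 2) :
    mallowsExp n q (fun π => (LDS π : ℝ)) ≤ 2 * m + 1 := by
  have hm0 : (2 : ℝ) ≤ m := by exact_mod_cast hm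
  have hn0 : (0 : ℝ) < n := by exact_mod_cast hn
  have hr : 0 < 1 - q := by linarith
  have hx4 : Real.sqrt (Real.sqrt q) ^ 4 = q := by
    rw [show 4 = 2 * 2 from rfl, pow_mul, Real.sq_sqrt (Real.sqrt_nonneg q), Real.sq_sqrt hq.le]
  have hx0 : 0 < Real.sqrt (Real.sqrt q) := by positivity
  have hx1 : Real.sqrt (Real.sqrt q) < 1 := by
    rw [Real.sqrt_lt' one_pos, one_pow, Real.sqrt_lt' one_pos, one_pow]; exact hq1
  have key := mallowsExp_LDS_le (N := n) (by omega : 1 ≤ m) hx0 hx1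
  have hlog : 4 * Real.log (Real.sqrt (Real.sqrt q)) = Real.log q := by
    rw [← hx4, Real.log_pow, hx4]; norm_num
  rw [hx4] at key
  refine key hN ?_
  have h1 : (950 / ((1 - q) * m ^ 2)) ^ m ≤ 1 := by
    refine pow_le_one₀ (by positivity) ?_
    rw [div_le_one (by positivity)]; exact hd
  have hl : Real.log (1 / q) = - Real.log q := by rw [one_div, Real.log_inv]
  have h2 : Real.sqrt (Real.sqrt q) ^ (m * (m - 1)) ≤ Real.exp (-(2 * Real.log n)) := by
    rw [← Real.exp_log (pow_pos hx0 (m * (m - 1))), Real.log_pow, Real.exp_le_exp]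
    push_cast [Nat.cast_sub (by omega : 1 ≤ m)]
    have h5 : Real.log q < 0 := Real.log_neg hq hq1
    rw [hl] at hmd
    have h6 : (m : ℝ) ^ 2 / 2 ≤ m * (m - 1) := by nlinarith
    have h7 : Real.log (Real.sqrt (Real.sqrt q)) = Real.log q / 4 := by linarith
    rw [h7]
    nlinarith
  have h3 : Real.exp (-(2 * Real.log n)) = ((n : ℝ) ^ 2)⁻¹ := by
    rw [Real.exp_neg, show 2 * Real.log n = Real.log n + Real.log n by ring, Real.exp_add,
      Real.exp_log hn0, sq]
  rw [h3] at h2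
  calc (n : ℝ) ^ 2 * Real.sqrt (Real.sqrt q) ^ (m * (m - 1)) * (950 / ((1 - q) * m ^ 2)) ^ m
      ≤ (n : ℝ) ^ 2 * ((n : ℝ) ^ 2)⁻¹ * 1 := by gcongr
    _ = 1 := by field_simp

lemma half_le_mallowsExp_LDS_of_exp_le {n m u : ℕ} (hm : 1 ≤ m) {q : ℝ}
    (hq : 0 < q) (hq1 : q < 1)
    (hs : (m : ℝ) * u * (3 + Real.exp (Real.log n / 2)) ≤ n)
    (hβ : Real.exp (-(Real.log n / 2)) ≤
      (1 - (1 - (1 - q) * u * q ^ (2 * (m * u))) ^ u) ^ m) :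
    (m : ℝ) / 2 ≤ mallowsExp n q (fun π => (LDS π : ℝ)) := by
  set E := Real.exp (Real.log n / 2) with hE
  have hE0 : 0 < E := Real.exp_pos _
  refine half_le_mallowsExp_LDS (u := u) (b := ⌈E⌉₊) hq hq1 hm ?_ ?_
  · have h1 : (⌈E⌉₊ : ℝ) ≤ E + 1 := (Nat.ceil_lt_add_one hE0.le).le
    have h2 : (0 : ℝ) ≤ m * u := by positivity
    have : (2 * (m * u) + ⌈E⌉₊ * (m * u) : ℝ) ≤ n := by nlinarith
    exact_mod_cast this
  · rw [Real.exp_neg, ← hE] at hβ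
    calc (1 : ℝ) = E * E⁻¹ := by field_simp
      _ ≤ _ := by
        have := Nat.le_ceil E
        gcongr

lemma log_le_two_mul_sqrt {x : ℝ} (hx : 0 < x) : Real.log x ≤ 2 * Real.sqrt x := by
  have h := Real.log_le_sub_one_of_pos (Real.sqrt_pos.2 hx)
  rw [Real.log_sqrt hx.le] at h
  linarith

lemma sq_log_le {n : ℕ} (hn : 1 ≤ n) : Real.log n ^ 2 ≤ 4 * n := by
  have hn' : (1 : ℝ) ≤ n := by exact_mod_cast hn
  have h0 : 0 ≤ Real.log n := Real.log_nonneg hn'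
  have h1 := log_le_two_mul_sqrt (by linarith : (0 : ℝ) < n)
  have h2 := Real.sq_sqrt (by linarith : (0 : ℝ) ≤ n)
  nlinarith [Real.sqrt_nonneg (n : ℝ)]

lemma exp_neg_two_mul_le_pow {r : ℝ} (h0 : 0 ≤ r) (h1 : r ≤ 1 / 2) {k : ℕ} {a : ℝ}
    (hk : k * r ≤ a) :
    Real.exp (-(2 * a)) ≤ (1 - r) ^ k := by
  have h2 : Real.exp (-(2 * r)) ≤ 1 - r := by
    rw [Real.exp_neg]
    refine inv_le_of_inv_le₀ (by linarith) ?_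
    have := Real.add_one_le_exp (2 * r)
    refine le_trans ?_ this
    rw [inv_le_iff_one_le_mul₀ (by linarith)]
    nlinarith
  calc Real.exp (-(2 * a)) ≤ Real.exp (-(2 * (k * r))) := Real.exp_le_exp.2 (by linarith)
    _ = Real.exp (-(2 * r)) ^ k := by rw [← Real.exp_nat_mul]; ring_nf
    _ ≤ _ := by gcongr

lemma four_le_mul_one_sub {n : ℕ} (hn : 2 ≤ n) {q : ℝ} (h : q ≤ 1 - 4 / (n : ℝ)) :
    4 ≤ n * (1 - q) := by
  have hn0 : (0 : ℝ) < n := by positivity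
  have h1 : 4 / (n : ℝ) ≤ 1 - q := by linarith
  rw [div_le_iff₀ hn0] at h1
  linarith

lemma log_natCast_pos {n : ℕ} (hn : 2 ≤ n) : 0 < Real.log n :=
  Real.log_pos (by exact_mod_cast hn)

lemma mallowsExp_LDS_le_of_near_one {n : ℕ} (hn : 2 ≤ n) {q : ℝ} (hq : 0 < q) (hq1 : q < 1)
    (h1 : 1 - 10 ^ 36 / (Real.log n) ^ 2 ≤ q) (h2 : q ≤ 1 - 4 / (n : ℝ)) :
    mallowsExp n q (fun π => (LDS π : ℝ)) ≤ 10 ^ 19 / Real.sqrt (1 - q) := by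
  have hL := log_natCast_pos hn
  set L := Real.log n with hLdef
  have hr : 0 < 1 - q := by linarith
  have hr1 : 1 - q < 1 := by linarith
  have hrL : (1 - q) * L ^ 2 ≤ 10 ^ 36 := by
    have : 1 - q ≤ 10 ^ 36 / L ^ 2 := by linarith
    rwa [le_div_iff₀ (by positivity)] at this
  set s := Real.sqrt (1 - q) with hs
  have hs0 : 0 < s := Real.sqrt_pos.2 hr
  have hss : s ^ 2 = 1 - q := Real.sq_sqrt hr.le
  have hs1 : s ≤ 1 := by nlinarith
  have hsL : s * L ≤ 10 ^ 18 := by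
    refine (sq_le_sq₀ (by positivity) (by norm_num)).1 ?_
    rw [mul_pow, hss]; norm_num at hrL ⊢; exact hrL
  set m := ⌈10 ^ 18 / s⌉₊ with hm
  have hm1 : 10 ^ 18 / s ≤ m := Nat.le_ceil _
  have hm2 : (m : ℝ) ≤ 10 ^ 18 / s + 1 := (Nat.ceil_lt_add_one (by positivity)).le
  have hm3 : 1 ≤ m := Nat.one_le_iff_ne_zero.2 (Nat.ceil_pos.2 (by positivity)).ne'
  have hm4 : 10 ^ 18 ≤ m * s := by rwa [div_le_iff₀ hs0] at hm1
  have hm5 : (2 : ℝ) * L ≤ m * 2 := by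
    have : L ≤ 10 ^ 18 / s := by rw [le_div_iff₀ hs0]; linarith
    linarith
  have he : Real.exp 2 ≤ 9 := by
    have h := Real.exp_one_lt_d9
    rw [show (2 : ℝ) = 1 + 1 by norm_num, Real.exp_add]
    nlinarith [Real.exp_pos 1]
  have key := mallowsExp_LDS_le_of_exp_le (n := n) (d := 2) hm3 (by omega) hq hq1
    (four_le_mul_one_sub hn h2)
    (by rw [← hss]; nlinarith) hm5
  refine key.trans ?_
  have h3 : 1 ≤ 1 / s := by rw [le_div_iff₀ hs0]; linarith
  calc (2 : ℝ) * m + 1 ≤ 2 * (10 ^ 18 / s + 1) + 3 * 1 := by linarith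
    _ ≤ 2 * (10 ^ 18 / s + 1 / s) + 3 * (1 / s) := by gcongr
    _ = (2 * 10 ^ 18 + 5) / s := by ring
    _ ≤ _ := by gcongr; norm_num

lemma sq_le_mul_exp_half {y : ℝ} (hy : 0 ≤ y) : y ^ 2 ≤ 16 * Real.exp (y / 2) := by
  have h := Real.add_one_le_exp (y / 4)
  have h2 : Real.exp (y / 2) = Real.exp (y / 4) ^ 2 := by rw [← Real.exp_nat_mul]; ring_nf
  rw [h2]
  nlinarith

lemma one_le_log_of_three_le {x : ℝ} (hx : 3 ≤ x) : 1 ≤ Real.log x := by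
  rw [Real.le_log_iff_exp_le (by linarith)]
  linarith [Real.exp_one_lt_d9]

lemma mallowsExp_LDS_le_of_intermediate {n : ℕ} (hn : 2 ≤ n) {q : ℝ} (hq : 0 < q) (hq1 : q < 1)
    (h : q ≤ 1 - 10 ^ 36 / (Real.log n) ^ 2) :
    mallowsExp n q (fun π => (LDS π : ℝ)) ≤
      10 ^ 19 * Real.log n / Real.log ((1 - q) * (Real.log n) ^ 2) := by
  have hL := log_natCast_pos hn
  have hL2 := sq_log_le (by omega : 1 ≤ n)
  have hn0 : (0 : ℝ) < n := by positivity
  set L := Real.log n with hLdef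
  have hr : 0 < 1 - q := by linarith
  have hr1 : 1 - q < 1 := by linarith
  have hrL : 10 ^ 36 ≤ (1 - q) * L ^ 2 := by
    have : 10 ^ 36 / L ^ 2 ≤ 1 - q := by linarith
    rwa [div_le_iff₀ (by positivity)] at this
  set y := Real.log ((1 - q) * L ^ 2) with hy
  have hy1 : 1 ≤ y := one_le_log_of_three_le (le_trans (by norm_num) hrL)
  have hey : Real.exp y = (1 - q) * L ^ 2 := Real.exp_log (by positivity)
  have hyL : y ≤ 2 * L := by
    have h1 : y ≤ Real.log (L ^ 2) := Real.log_le_log (by positivity) (by nlinarith [sq_nonneg L])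
    rw [Real.log_pow] at h1
    have := Real.log_le_sub_one_of_pos hL
    push_cast at h1
    linarith
  set m := ⌈124 * L / y⌉₊ with hm
  have hm1 : 124 * L / y ≤ m := Nat.le_ceil _
  have hm2 : (m : ℝ) ≤ 124 * L / y + 1 := (Nat.ceil_lt_add_one (by positivity)).le
  have hm3 : 1 ≤ m := Nat.one_le_iff_ne_zero.2 (Nat.ceil_pos.2 (by positivity)).ne'
  have hm4 : 124 * L ≤ m * y := by rwa [div_le_iff₀ (by positivity)] at hm1
  have key := mallowsExp_LDS_le_of_exp_le (n := n) (d := y / 2) hm3 (by omega) hq hq1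
    (by nlinarith) ?_ (by linarith)
  · refine key.trans ?_
    have h3 : 1 ≤ 2 * L / y := by rw [le_div_iff₀ (by linarith)]; linarith
    calc (2 : ℝ) * m + 1 ≤ 2 * (124 * L / y + 1) + 3 * 1 := by linarith
      _ ≤ 2 * (124 * L / y + 2 * L / y) + 3 * (2 * L / y) := by gcongr
      _ = (258 * L) / y := by ring
      _ ≤ _ := by gcongr; norm_num
  · have hb := sq_le_mul_exp_half (by linarith : 0 ≤ y)
    have he : Real.exp y = Real.exp (y / 2) ^ 2 := by rw [← Real.exp_nat_mul]; ring_nf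
    have h5 : (1 - q) * (124 * L) ^ 2 ≤ (1 - q) * (m * y) ^ 2 := by gcongr
    have h6 : (1 - q) * (m * y) ^ 2 ≤ (1 - q) * m ^ 2 * (16 * Real.exp (y / 2)) := by
      rw [mul_pow, ← mul_assoc]; gcongr
    have h7 : 15376 * Real.exp (y / 2) ^ 2 ≤ (1 - q) * m ^ 2 * (16 * Real.exp (y / 2)) := by
      rw [← he, hey]; nlinarith
    have hp := Real.exp_pos (y / 2)
    have h8 : Real.exp (y / 2) * (15376 * Real.exp (y / 2)) ≤
        Real.exp (y / 2) * (16 * ((1 - q) * m ^ 2)) := by nlinarith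
    have h9 := le_of_mul_le_mul_left h8 hp
    linarith

lemma le_log_of_far {n : ℕ} (hn : 2 ≤ n) {q : ℝ} (hq : 0 < q)
    (h : q ≤ 1 - 1000 * (Real.log (Real.log n)) ^ 2 / Real.log n) :
    36000 ≤ Real.log n := by
  have hL := log_natCast_pos hn
  set L := Real.log n with hLdef
  have hlt : 1000 * (Real.log L) ^ 2 < L := by
    have : 1000 * (Real.log L) ^ 2 / L < 1 := by linarith
    rwa [div_lt_one hL] at this
  have hlow : 1 - L⁻¹ ≤ Real.log L := Real.one_sub_inv_le_log_of_pos hL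
  have hup : Real.log L ≤ L - 1 := Real.log_le_sub_one_of_pos hL
  rcases Nat.lt_or_ge 2 n with h2 | h2
  · have h3 : (3 : ℝ) ≤ n := by exact_mod_cast h2
    have hL1 : 1.05 ≤ L := by
      rw [hLdef, Real.le_log_iff_exp_le (by linarith)]
      refine le_trans ?_ h3
      have h5 := Real.add_one_le_exp (-0.05)
      have h6 : Real.exp 1.05 * Real.exp (-0.05) = Real.exp 1 := by
        rw [← Real.exp_add]; norm_num
      have h7 := Real.exp_one_lt_d9
      nlinarith [Real.exp_pos 1.05]
    have h4 : 1.05 ≤ L → L⁻¹ ≤ 0.953 := fun h => by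
      rw [inv_le_comm₀ (by linarith) (by norm_num)]; linarith
    have h8 : 0.047 ≤ Real.log L := by have := h4 hL1; linarith
    have hL2 : 2.1 ≤ L := by nlinarith
    have h9 : L⁻¹ ≤ 0.5 := by
      rw [inv_le_comm₀ (by linarith) (by norm_num)]; linarith
    have h10 : 0.5 ≤ Real.log L := by linarith
    have hL3 : 250 ≤ L := by nlinarith
    have h11 : 5 ≤ Real.log 250 := by
      rw [Real.le_log_iff_exp_le (by norm_num)]
      have : Real.exp 5 = Real.exp 1 ^ 5 := by rw [← Real.exp_nat_mul]; norm_num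
      rw [this]
      calc Real.exp 1 ^ 5 ≤ 2.72 ^ 5 := by
            have := Real.exp_one_lt_d9
            gcongr; linarith
        _ ≤ 250 := by norm_num
    have h12 : 5 ≤ Real.log L := h11.trans (Real.log_le_log (by norm_num) hL3)
    have hL4 : 25000 ≤ L := by nlinarith
    have h13 : 6 ≤ Real.log 25000 := by
      rw [Real.le_log_iff_exp_le (by norm_num)]
      have : Real.exp 6 = Real.exp 1 ^ 6 := by rw [← Real.exp_nat_mul]; norm_num
      rw [this]
      calc Real.exp 1 ^ 6 ≤ 2.72 ^ 6 := by
            have := Real.exp_one_lt_d9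
            gcongr; linarith
        _ ≤ 25000 := by norm_num
    have h14 : 6 ≤ Real.log L := h13.trans (Real.log_le_log (by norm_num) hL4)
    nlinarith
  · obtain rfl : n = 2 := by omega
    have hl : L < 0.7 := by
      have := Real.log_two_lt_d9
      rw [hLdef]; push_cast; linarith
    nlinarith

lemma mallowsExp_LDS_le_of_far {n : ℕ} (hn : 2 ≤ n) {q : ℝ} (hq : 0 < q) (hq1 : q < 1)
    (h1 : 1 / (n : ℝ) ≤ q)
    (h : q ≤ 1 - 1000 * (Real.log (Real.log n)) ^ 2 / Real.log n) :
    mallowsExp n q (fun π => (LDS π : ℝ)) ≤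
      10 ^ 19 * Real.sqrt (Real.log n / Real.log (1 / q)) := by
  have hL := le_log_of_far hn hq h
  have hL2 := sq_log_le (by omega : 1 ≤ n)
  have hn0 : (0 : ℝ) < n := by positivity
  set L := Real.log n with hLdef
  have hr : 0 < 1 - q := by linarith
  have hrL : 1000 ≤ (1 - q) * L := by
    have h2 : 1 ≤ Real.log L := one_le_log_of_three_le (by linarith)
    have : 1000 * (Real.log L) ^ 2 / L ≤ 1 - q := by linarith
    rw [div_le_iff₀ (by linarith)] at this
    nlinarith
  have hl : Real.log (1 / q) = - Real.log q := by rw [one_div, Real.log_inv]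
  have hl1 : 1 - q ≤ Real.log (1 / q) := by
    rw [hl]; have := Real.log_le_sub_one_of_pos hq; linarith
  have hlL : Real.log (1 / q) ≤ L := by
    refine Real.log_le_log (by positivity) ?_
    rwa [one_div_le hq hn0]
  set l := Real.log (1 / q) with hldef
  have hl0 : 0 < l := by linarith
  set w := Real.sqrt (L / l) with hw
  have hw2 : w ^ 2 = L / l := Real.sq_sqrt (by positivity)
  have hw1 : 1 ≤ w := by
    rw [hw, Real.one_le_sqrt, le_div_iff₀ hl0]; linarith
  have hwl : w ^ 2 * l = L := by rw [hw2]; field_simp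
  set m := ⌈60 * w⌉₊ with hm
  have hm1 : 60 * w ≤ m := Nat.le_ceil _
  have hm2 : (m : ℝ) ≤ 60 * w + 1 := (Nat.ceil_lt_add_one (by positivity)).le
  have hm3 : 60 ≤ m := by
    have : (60 : ℝ) ≤ m := by linarith
    exact_mod_cast this
  have hmw : (60 * w) ^ 2 ≤ (m : ℝ) ^ 2 := by gcongr
  have key := mallowsExp_LDS_le_of_log_le (n := n) (m := m) (by omega) (by omega) hq hq1
    (by nlinarith) ?_ (by nlinarith)
  · refine key.trans ?_
    linarith
  · rcases le_or_gt (1 / 2) q with hq2 | hq2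
    · have hl2 : l ≤ 2 * (1 - q) := by
        rw [hl]
        have h3 : 1 - q⁻¹ ≤ Real.log q := Real.one_sub_inv_le_log_of_pos hq
        have h4 : q⁻¹ - 1 ≤ 2 * (1 - q) := by
          have : q⁻¹ - 1 = (1 - q) * q⁻¹ := by field_simp
          rw [this]
          have : q⁻¹ ≤ 2 := by rw [inv_le_comm₀ hq (by norm_num)]; linarith
          nlinarith
        linarith
      nlinarith [sq_nonneg w]
    · have : (60 : ℝ) ^ 2 ≤ (m : ℝ) ^ 2 := by
        have : (60 : ℝ) ≤ m := by exact_mod_cast hm3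
        gcongr
      nlinarith

lemma exp_neg_four_lower : (1 : ℝ) / 55 ≤ Real.exp (-4) := by
  rw [Real.exp_neg, one_div]
  refine inv_anti₀ (Real.exp_pos _) ?_
  have : Real.exp 4 = Real.exp 1 ^ 4 := by rw [← Real.exp_nat_mul]; norm_num
  rw [this]
  calc Real.exp 1 ^ 4 ≤ 2.7183 ^ 4 := by
        have := Real.exp_one_lt_d9
        gcongr; linarith
    _ ≤ 55 := by norm_num

lemma half_le_binTail {p : ℝ} (hp0 : 0 ≤ p) (hp1 : p ≤ 1) {T m : ℕ} (hm : 1 ≤ m)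
    (hTp : 4 * (m : ℝ) ≤ T * p) : 1 / 2 ≤ binTail p T m := by
  have hch := binTail_chernoff hp0 hp1 T m
  have hhalf : (2 : ℝ) ^ m * (1 - p / 2) ^ T ≤ 1 / 2 := by
    have h6 : (1 - p / 2) ^ T ≤ Real.exp (-(T * p / 2)) := by
      have h7 : 1 - p / 2 ≤ Real.exp (-(p / 2)) := by
        have := Real.add_one_le_exp (-(p / 2)); linarith
      calc (1 - p / 2) ^ T ≤ Real.exp (-(p / 2)) ^ T := by
            have : 0 ≤ 1 - p / 2 := by linarith
            gcongr
        _ = _ := by rw [← Real.exp_nat_mul]; ring_nf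
    have h8 : Real.exp (-(T * p / 2)) ≤ Real.exp (-2) ^ m := by
      rw [← Real.exp_nat_mul, Real.exp_le_exp]; linarith
    have h9 : Real.exp (-2) ≤ 1 / 4 := by
      rw [Real.exp_neg, one_div]
      refine inv_anti₀ (by norm_num) ?_
      have := Real.add_one_le_exp 1
      have h10 : Real.exp 2 = Real.exp 1 ^ 2 := by rw [← Real.exp_nat_mul]; norm_num
      rw [h10]; nlinarith
    calc (2 : ℝ) ^ m * (1 - p / 2) ^ T ≤ 2 ^ m * (1 / 4) ^ m := by
          gcongr
          exact (h6.trans h8).trans (by gcongr)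
      _ = (1 / 2) ^ m := by rw [← mul_pow]; norm_num
      _ ≤ (1 / 2) ^ 1 := pow_le_pow_of_le_one (by norm_num) (by norm_num) hm
      _ = 1 / 2 := by norm_num
  linarith

set_option maxHeartbeats 800000 in
lemma le_mallowsExp_LDS_of_near_one {n : ℕ} (hn : 2 ≤ n) {q : ℝ} (hq : 0 < q) (hq1 : q < 1)
    (h2 : q ≤ 1 - 4 / (n : ℝ)) :
    1 / 1000 / Real.sqrt (1 - q) ≤ mallowsExp n q (fun π => (LDS π : ℝ)) := by
  have hr : 0 < 1 - q := by linarith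
  have hnr := four_le_mul_one_sub hn h2
  set s := Real.sqrt (1 - q) with hs
  have hs0 : 0 < s := Real.sqrt_pos.2 hr
  have hss : s ^ 2 = 1 - q := Real.sq_sqrt hr.le
  rcases le_or_gt (1 / 23) s with hs1 | hs1
  · refine le_trans ?_ (one_le_mallowsExp_LDS (by omega) hq)
    rw [div_le_one hs0]; linarith
  set m := ⌊1 / (23 * s)⌋₊ with hm
  have hx1 : 1 ≤ 1 / (23 * s) := by rw [le_div_iff₀ (by positivity)]; linarith
  have hm1 : (m : ℝ) ≤ 1 / (23 * s) := Nat.floor_le (by positivity)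
  have hm2 : 1 / (23 * s) < m + 1 := Nat.lt_floor_add_one _
  have hm3 : 1 ≤ m := Nat.one_le_floor_iff _ |>.2 hx1
  have hm3' : (1 : ℝ) ≤ m := by exact_mod_cast hm3
  have hm4 : m * (23 * s) ≤ 1 := by rwa [le_div_iff₀ (by positivity)] at hm1
  have hm5 : 1 ≤ 2 * m * (23 * s) := by
    rw [div_lt_iff₀ (by positivity)] at hm2
    nlinarith
  have hr2 : 1 - q ≤ 1 / 529 := by rw [← hss]; nlinarith
  set T := ⌊1 / (1 - q)⌋₊ with hT
  have hT1 : (T : ℝ) ≤ 1 / (1 - q) := Nat.floor_le (by positivity)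
  have hT2 : 1 / (1 - q) < T + 1 := Nat.lt_floor_add_one _
  have hT3 : T * (1 - q) ≤ 1 := by rwa [le_div_iff₀ hr] at hT1
  have hT4 : 528 / 529 ≤ T * (1 - q) := by
    rw [div_lt_iff₀ hr] at hT2; linarith
  have hmT : m ≤ T := by
    have : (m : ℝ) ≤ T := by
      by_contra hcon
      push Not at hcon
      have : (T : ℝ) * (1 - q) ≤ m * (1 - q) := by gcongr
      have h4 : (m : ℝ) * (1 - q) = (m * (23 * s)) * (s / 23) := by rw [← hss]; ring
      nlinarith
    exact_mod_cast this
  have hdiv : (T : ℝ) ≤ 2 * m * (T / m : ℕ) := by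
    have h3 : T < m * (T / m) + m := by
      have := Nat.lt_mul_div_succ T (by omega : 0 < m)
      linarith
    have h4 : 1 ≤ T / m := (Nat.one_le_div_iff (by omega)).2 hmT
    have : T ≤ 2 * m * (T / m) := by nlinarith
    exact_mod_cast this
  have hM : T + T / m * m ≤ 2 * T := by
    have := Nat.div_mul_le_self T m
    omega
  have hs' : T / m ≤ 2 * T := (Nat.div_le_self T m).trans (by omega)
  have hn' : 2 * T + T ≤ n := by
    have : (2 * T + T : ℝ) ≤ n := by
      have h5 : (2 * T + T : ℝ) * (1 - q) ≤ n * (1 - q) := by linarith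
      exact le_of_mul_le_mul_right h5 hr
    exact_mod_cast this
  have key := binTail_le_mallowsExp hq hq1 hs' hM hn'
  have hp1 := window_prob_le_one hq hq1 hs'
  have hpow : 1 / 55 ≤ q ^ (2 * T) := by
    have h5 := exp_neg_two_mul_le_pow (k := 2 * T) (a := 2) hr.le (by linarith)
      (by push_cast; linarith)
    rw [sub_sub_cancel] at h5
    refine exp_neg_four_lower.trans (le_trans (by norm_num) h5)
  set p := (1 - q) * (T / m : ℕ) * q ^ (2 * T) with hp
  have hp0 : 0 ≤ p := by positivity
  have hTp : 4 * (m : ℝ) ≤ T * p := by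
    have h6 : (1 - q) * (T / m : ℕ) * (1 / 55) ≤ p := by rw [hp]; gcongr
    have h7 : (T : ℝ) * (T * (1 - q)) ≤ 110 * m * (T * p) := by
      have h8 : (T : ℝ) * (1 - q) ≤ 2 * m * (T / m : ℕ) * (1 - q) := by gcongr
      have h9 : (T : ℝ) * (1 - q) ≤ 110 * m * p := by nlinarith
      nlinarith [Nat.cast_nonneg (α := ℝ) T]
    have h10 : (528 / 529) ^ 2 ≤ (T * (1 - q)) ^ 2 := by gcongr
    have h11 : (T * (1 - q)) ^ 2 ≤ (1 - q) * (110 * m * (T * p)) := by nlinarith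
    have h12 : (1 - q) * m ^ 2 ≤ 1 / 529 := by
      rw [← hss]
      have : (m * (23 * s)) ^ 2 ≤ 1 := pow_le_one₀ (by positivity) hm4
      nlinarith
    by_contra hcon
    push Not at hcon
    have h13 : (1 - q) * (110 * m * (T * p)) ≤ (1 - q) * (110 * m * (4 * m)) := by gcongr
    nlinarith
  have hb := half_le_binTail hp0 hp1 hm3 hTp
  refine le_trans ?_ key
  calc 1 / 1000 / s ≤ m * (1 / 2) := by
        rw [div_le_iff₀ hs0]; nlinarith
    _ ≤ _ := by gcongr

lemma mul_three_add_exp_le {L : ℝ} (hL : 200 ≤ L) {n : ℕ} (hn : 1 ≤ n) (hnL : L = Real.log n)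
    {k : ℝ}
    (hk : k ≤ L ^ 2) : k * (3 + Real.exp (L / 2)) ≤ n := by
  have hn0 : (0 : ℝ) < n := by exact_mod_cast hn
  have h1 : (n : ℝ) = Real.exp (L / 2) ^ 2 := by
    rw [← Real.exp_nat_mul, hnL, ← Real.exp_log hn0]; simp; ring_nf
  have h2 : Real.exp (L / 2) = Real.exp (L / 8) ^ 4 := by rw [← Real.exp_nat_mul]; ring_nf
  have h3 := Real.add_one_le_exp (L / 8)
  have h4 : (L / 8) ^ 4 ≤ Real.exp (L / 8) ^ 4 := by gcongr; linarith
  have h5 : 4 * L ^ 2 ≤ Real.exp (L / 2) := by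
    have hz : 16384 ≤ L ^ 2 := by nlinarith
    rw [h2]; nlinarith [mul_nonneg (sq_nonneg L) (sub_nonneg.2 hz)]
  have h6 : 1 ≤ Real.exp (L / 2) := Real.one_le_exp (by linarith)
  rw [h1]
  calc k * (3 + Real.exp (L / 2)) ≤ L ^ 2 * (3 * Real.exp (L / 2) + Real.exp (L / 2)) := by
        gcongr; linarith
    _ = 4 * L ^ 2 * Real.exp (L / 2) := by ring
    _ ≤ _ := by rw [sq (Real.exp _)]; gcongr

lemma half_le_mallowsExp_LDS_single {n m : ℕ} (hm : 1 ≤ m) (hn : 1 ≤ n) {q : ℝ}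
    (hq : 0 < q) (hq1 : q < 1) (hL : 200 ≤ Real.log n) (hmL : (m : ℝ) ≤ Real.log n)
    {d : ℝ} (hd : Real.exp (-d) ≤ q)
    (h : m * -Real.log (1 - q) + 2 * m ^ 2 * d ≤ Real.log n / 2) :
    (m : ℝ) / 2 ≤ mallowsExp n q (fun π => (LDS π : ℝ)) := by
  have hr : 0 < 1 - q := by linarith
  refine half_le_mallowsExp_LDS_of_exp_le (u := 1) hm hq hq1 ?_ ?_
  · exact mul_three_add_exp_le hL hn rfl (by push_cast; nlinarith)
  · have h1 : (1 - (1 - (1 - q) * ((1 : ℕ) : ℝ) * q ^ (2 * (m * 1))) ^ 1) =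
        (1 - q) * q ^ (2 * m) := by
      push_cast; ring_nf
    rw [h1]
    calc Real.exp (-(Real.log n / 2))
        ≤ Real.exp (m * Real.log (1 - q) + m * ((2 * m : ℕ) * -d)) :=
          Real.exp_le_exp.2 (by push_cast; nlinarith)
      _ = ((1 - q) * Real.exp (-d) ^ (2 * m)) ^ m := by
          rw [Real.exp_add, Real.exp_nat_mul, Real.exp_nat_mul, Real.exp_nat_mul,
            Real.exp_log hr, mul_pow]
      _ ≤ _ := by gcongr

lemma le_mallowsExp_LDS_of_far {n : ℕ} (hn : 2 ≤ n) {q : ℝ} (hq : 0 < q) (hq1 : q < 1)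
    (h : q ≤ 1 - 1000 * (Real.log (Real.log n)) ^ 2 / Real.log n) :
    1 / 1000 * Real.sqrt (Real.log n / Real.log (1 / q)) ≤
      mallowsExp n q (fun π => (LDS π : ℝ)) := by
  have hL := le_log_of_far hn hq h
  have key := fun m hm hmL h1 h2 => half_le_mallowsExp_LDS_single (n := n) (m := m) hm
    (by omega) hq hq1 (by linarith) hmL (d := Real.log (1 / q)) h1 h2
  set L := Real.log n with hLdef
  have hr : 0 < 1 - q := by linarith
  have hl : Real.log (1 / q) = - Real.log q := by rw [one_div, Real.log_inv]
  have hl1 : 1 - q ≤ Real.log (1 / q) := by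
    rw [hl]; have := Real.log_le_sub_one_of_pos hq; linarith
  have hql : Real.exp (-Real.log (1 / q)) ≤ q := by
    rw [hl, neg_neg, Real.exp_log hq]
  set l := Real.log (1 / q) with hldef
  have hl0 : 0 < l := by linarith
  set w := Real.sqrt (L / l) with hw
  have hw2 : w ^ 2 = L / l := Real.sq_sqrt (by positivity)
  have hwl : w ^ 2 * l = L := by rw [hw2]; field_simp
  rcases lt_or_ge w 8 with hw8 | hw8
  · exact le_trans (by linarith) (one_le_mallowsExp_LDS (by omega) hq)
  have hlogL : 1 ≤ Real.log L := one_le_log_of_three_le (by linarith)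
  have hrL : 1000 * (Real.log L) ^ 2 ≤ (1 - q) * L := by
    have : 1000 * (Real.log L) ^ 2 / L ≤ 1 - q := by linarith
    rwa [div_le_iff₀ (by linarith)] at this
  have hlogr : -Real.log (1 - q) ≤ Real.log L := by
    have : 0 ≤ Real.log ((1 - q) * L) := Real.log_nonneg (by nlinarith)
    rw [Real.log_mul hr.ne' (by linarith)] at this
    linarith
  have hwL : w * Real.log L ≤ L / 31 := by
    refine (sq_le_sq₀ (by positivity) (by positivity)).1 ?_
    have h3 : w ^ 2 * (1 - q) ≤ L := by rw [← hwl]; gcongr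
    have h4 : w ^ 2 * (1000 * Real.log L ^ 2) ≤ w ^ 2 * ((1 - q) * L) := by gcongr
    nlinarith
  set m := ⌊w / 4⌋₊ with hm
  have hm1 : (m : ℝ) ≤ w / 4 := Nat.floor_le (by positivity)
  have hm2 : w / 4 < m + 1 := Nat.lt_floor_add_one _
  have hm3 : 1 ≤ m := Nat.one_le_floor_iff _ |>.2 (by linarith)
  refine le_trans ?_ (key m hm3 ?_ hql ?_)
  · linarith
  · nlinarith
  · have h5 : (m : ℝ) * -Real.log (1 - q) ≤ w / 4 * Real.log L := by
      calc (m : ℝ) * -Real.log (1 - q) ≤ m * Real.log L := by gcongr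
        _ ≤ _ := by gcongr
    have h6 : 2 * (m : ℝ) ^ 2 * l ≤ 2 * (w / 4) ^ 2 * l := by gcongr
    nlinarith

lemma le_log_of_intermediate {n : ℕ} (hn : 2 ≤ n) {q : ℝ}
    (h1 : 1 - 1000 * (Real.log (Real.log n)) ^ 2 / Real.log n ≤ q)
    (h2 : q ≤ 1 - 10 ^ 36 / (Real.log n) ^ 2) :
    10 ^ 11 ≤ Real.log n := by
  have hL := log_natCast_pos hn
  have hLn : 0.69 ≤ Real.log n := by
    have := Real.log_le_log (by norm_num) (by exact_mod_cast hn : (2 : ℝ) ≤ n)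
    linarith [Real.log_two_gt_d9]
  set L := Real.log n with hLdef
  have h3 : 10 ^ 36 ≤ 1000 * (Real.log L) ^ 2 * L := by
    have h4 : 10 ^ 36 / L ^ 2 ≤ 1000 * (Real.log L) ^ 2 / L := by linarith
    rw [div_le_div_iff₀ (by positivity) hL] at h4
    have h5 : L * 10 ^ 36 ≤ L * (1000 * (Real.log L) ^ 2 * L) := by linarith
    exact le_of_mul_le_mul_left h5 hL
  have hup : Real.log L ≤ L - 1 := Real.log_le_sub_one_of_pos hL
  have hlow : 1 - L⁻¹ ≤ Real.log L := Real.one_sub_inv_le_log_of_pos hL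
  have hinv : L⁻¹ ≤ 2 := by rw [inv_le_comm₀ hL (by norm_num)]; linarith
  rcases le_or_gt L 1 with hL1 | hL1
  · have h6 : (Real.log L) ^ 2 ≤ 1 := by nlinarith
    nlinarith
  · have h0 : 0 ≤ Real.log L := Real.log_nonneg hL1.le
    by_contra hcon
    push Not at hcon
    have h6 : Real.log L ≤ 10 ^ 11 - 1 := by linarith
    have : 1000 * (Real.log L) ^ 2 * L ≤ 1000 * (10 ^ 11 - 1) ^ 2 * 10 ^ 11 := by gcongr
    norm_num at this h3
    linarith

lemma exp_neg_le_one_sub_pow {p y : ℝ} {u : ℕ} (hp : p ≤ 1)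
    {a : ℝ} (ha : 0 < a) (hau : a ≤ p * u) (hy : 1 + 1 / a ≤ Real.exp y) :
    Real.exp (-y) ≤ 1 - (1 - p) ^ u := by
  have h1 : (1 - p) ^ u ≤ Real.exp (-a) := by
    have h2 : 1 - p ≤ Real.exp (-p) := by have := Real.add_one_le_exp (-p); linarith
    calc (1 - p) ^ u ≤ Real.exp (-p) ^ u := by
          have : 0 ≤ 1 - p := by linarith
          gcongr
      _ = Real.exp (-(p * u)) := by rw [← Real.exp_nat_mul]; ring_nf
      _ ≤ _ := Real.exp_le_exp.2 (by linarith)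
  have h3 : Real.exp (-a) ≤ 1 / (1 + a) := by
    rw [Real.exp_neg, one_div]
    exact inv_anti₀ (by linarith) (by linarith [Real.add_one_le_exp a])
  have h4 : Real.exp (-y) ≤ 1 - 1 / (1 + a) := by
    have h5 : 1 - 1 / (1 + a) = (1 + 1 / a)⁻¹ := by field_simp; ring
    rw [h5, Real.exp_neg]
    exact inv_anti₀ (by positivity) hy
  linarith

lemma half_le_mallowsExp_LDS_of_mul_log_le_one {n m : ℕ} (hm : 1 ≤ m) (hn : 1 ≤ n) {q y : ℝ}
    (hq : 0 < q) (hq1 : q < 1) (hq2 : 1 / 2 ≤ q) (hL : 200 ≤ Real.log n)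
    (hrL : 1 ≤ (1 - q) * Real.log n ^ 2) (hrm : (1 - q) * m ≤ 1 / 2)
    (hy : 1 + 220 * (1 - q) * m ^ 2 ≤ Real.exp y) (hmy : m * y ≤ Real.log n / 2) :
    (m : ℝ) / 2 ≤ mallowsExp n q (fun π => (LDS π : ℝ)) := by
  have hr : 0 < 1 - q := by linarith
  have hm0 : (1 : ℝ) ≤ m := by exact_mod_cast hm
  have hrm0 : 0 < (1 - q) * m := by positivity
  set u := ⌊1 / ((1 - q) * m)⌋₊ with hu
  have hu1 : (u : ℝ) ≤ 1 / ((1 - q) * m) := Nat.floor_le (by positivity)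
  have hu2 : 1 / ((1 - q) * m) < u + 1 := Nat.lt_floor_add_one _
  have hu3 : u * ((1 - q) * m) ≤ 1 := by rwa [le_div_iff₀ hrm0] at hu1
  have hu4 : 1 / 2 ≤ u * ((1 - q) * m) := by
    rw [div_lt_iff₀ hrm0] at hu2; linarith
  have hp1 := window_prob_le_one hq hq1 (s := u) (M := 2 * (m * u)) (by nlinarith)
  have hpow : 1 / 55 ≤ q ^ (2 * (m * u)) := by
    have h5 := exp_neg_two_mul_le_pow (k := 2 * (m * u)) (a := 2) hr.le (by linarith)
      (by push_cast; nlinarith)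
    rw [sub_sub_cancel] at h5
    refine exp_neg_four_lower.trans (le_trans (by norm_num) h5)
  refine half_le_mallowsExp_LDS_of_exp_le (u := u) hm hq hq1 ?_ ?_
  · refine mul_three_add_exp_le hL hn rfl ?_
    have h6 : (m : ℝ) * u * (1 - q) ≤ Real.log n ^ 2 * (1 - q) := by nlinarith
    exact le_of_mul_le_mul_right h6 hr
  · set p := (1 - q) * u * q ^ (2 * (m * u)) with hp
    have hpu : (1 - q) * u * (1 / 55) ≤ p := by rw [hp]; gcongr
    have ha : 1 / (220 * (1 - q) * m ^ 2) ≤ p * u := by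
      rw [div_le_iff₀ (by positivity)]
      have h7 : (1 / 2) ^ 2 ≤ (u * ((1 - q) * m)) ^ 2 := by gcongr
      have h8 : (1 - q) * u * (1 / 55) * (u * (220 * (1 - q) * m ^ 2)) ≤
          p * (u * (220 * (1 - q) * m ^ 2)) := by gcongr
      nlinarith
    have h9 := exp_neg_le_one_sub_pow hp1 (by positivity) ha
      (y := y) (by rwa [one_div_one_div])
    calc Real.exp (-(Real.log n / 2)) ≤ Real.exp (-y) ^ m := by
          rw [← Real.exp_nat_mul, Real.exp_le_exp]; linarith
      _ ≤ _ := by gcongr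

set_option maxHeartbeats 800000 in
lemma le_mallowsExp_LDS_of_intermediate {n : ℕ} (hn : 2 ≤ n) {q : ℝ} (hq : 0 < q) (hq1 : q < 1)
    (h1 : 1 - 1000 * (Real.log (Real.log n)) ^ 2 / Real.log n ≤ q)
    (h2 : q ≤ 1 - 10 ^ 36 / (Real.log n) ^ 2) :
    1 / 1000 * Real.log n / Real.log ((1 - q) * (Real.log n) ^ 2) ≤
      mallowsExp n q (fun π => (LDS π : ℝ)) := by
  have hL := le_log_of_intermediate hn h1 h2
  have key1 := fun m y hm hq2 hrL hrm hy hmy =>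
    half_le_mallowsExp_LDS_of_mul_log_le_one (n := n) (m := m) (y := y) hm (by omega) hq hq1 hq2
      (by linarith) hrL hrm hy hmy
  have key2 := fun m d hm hmL h1 h2 => half_le_mallowsExp_LDS_single (n := n) (m := m) hm
    (by omega) hq hq1 (by linarith) hmL (d := d) h1 h2
  set L := Real.log n with hLdef
  have hL0 : 0 < L := by linarith
  have hr : 0 < 1 - q := by linarith
  have hrup : (1 - q) * L ≤ 1000 * Real.log L ^ 2 := by
    have : 1 - q ≤ 1000 * Real.log L ^ 2 / L := by linarith
    rwa [le_div_iff₀ hL0] at this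
  have hrL : 10 ^ 36 ≤ (1 - q) * L ^ 2 := by
    have : 10 ^ 36 / L ^ 2 ≤ 1 - q := by linarith
    rwa [div_le_iff₀ (by positivity)] at this
  obtain ⟨g, hg0, hg4⟩ : ∃ g : ℝ, 0 < g ∧ g ^ 4 = L := by
    refine ⟨Real.sqrt (Real.sqrt L), by positivity, ?_⟩
    rw [show 4 = 2 * 2 from rfl, pow_mul, Real.sq_sqrt (Real.sqrt_nonneg L), Real.sq_sqrt hL0.le]
  have hg : 500 ≤ g := by
    refine le_of_pow_le_pow_left₀ (n := 4) (by norm_num) hg0.le ?_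
    rw [hg4]; linarith
  have hlogL1 : 1 ≤ Real.log L := one_le_log_of_three_le (by linarith)
  have hlogLg : Real.log L ≤ 4 * g := by
    rw [← hg4, Real.log_pow]
    have := Real.log_le_sub_one_of_pos hg0
    push_cast; linarith
  have hg2 : 250000 ≤ g ^ 2 := by nlinarith
  have hgL : L = g ^ 2 * g ^ 2 := by rw [← hg4]; ring
  have hr2 : 1 - q ≤ 1 / 2 := by
    have h3 : Real.log L ^ 2 ≤ (4 * g) ^ 2 := by gcongr
    have h4 : (1 - q) * L ≤ 1 / 2 * L := by nlinarith
    exact le_of_mul_le_mul_right h4 hL0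
  set y := Real.log ((1 - q) * L ^ 2) with hy
  have hey : Real.exp y = (1 - q) * L ^ 2 := Real.exp_log (by positivity)
  have hy1 : 10 ≤ y := by
    rw [hy, Real.le_log_iff_exp_le (by positivity)]
    refine le_trans ?_ hrL
    have : Real.exp 10 = Real.exp 1 ^ 10 := by rw [← Real.exp_nat_mul]; norm_num
    rw [this]
    calc Real.exp 1 ^ 10 ≤ 3 ^ 10 := by
          have := Real.exp_one_lt_d9
          gcongr; linarith
      _ ≤ 10 ^ 36 := by norm_num
  have hyL : y ≤ 2 * Real.log L := by
    have h1 : y ≤ Real.log (L ^ 2) :=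
      Real.log_le_log (by positivity) (by nlinarith [sq_nonneg L])
    rw [Real.log_pow] at h1
    exact_mod_cast h1
  have hy0 : 0 < y := by linarith
  have hyg : 100 * y ≤ L := by nlinarith
  set m := ⌊L / (100 * y)⌋₊ with hm
  have hx1 : 1 ≤ L / (100 * y) := by rw [le_div_iff₀ (by positivity)]; linarith
  have hm1 : (m : ℝ) ≤ L / (100 * y) := Nat.floor_le (by positivity)
  have hm2 : L / (100 * y) < m + 1 := Nat.lt_floor_add_one _
  have hm3 : 1 ≤ m := Nat.one_le_floor_iff _ |>.2 hx1
  have hm3' : (1 : ℝ) ≤ m := by exact_mod_cast hm3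
  have hmy : m * y ≤ L / 100 := by
    rw [le_div_iff₀ (by positivity)] at hm1; linarith
  have hmy2 : L / 200 ≤ m * y := by
    rw [div_lt_iff₀ (by positivity)] at hm2; nlinarith
  have hmL : (m : ℝ) ≤ L := by nlinarith
  refine le_trans (b := (m : ℝ) / 2) ?_ ?_
  · rw [div_le_iff₀ hy0]; nlinarith
  have hmysq : (m * y) ^ 2 ≤ (L / 100) ^ 2 := by gcongr
  rcases le_or_gt ((1 - q) * L) 1 with hrL1 | hrL1
  · refine key1 m y hm3 (by linarith) (by linarith) ?_ ?_ (by linarith)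
    · have : (m : ℝ) ≤ L / 2 := by nlinarith
      nlinarith
    · rw [hey]
      have h3 : (m : ℝ) ^ 2 * 100 ≤ (m * y) ^ 2 := by
        rw [mul_pow]; gcongr; nlinarith
      have h4 : (1 - q) * (m : ℝ) ^ 2 ≤ (1 - q) * (L ^ 2 / 1000000) := by
        gcongr; nlinarith
      nlinarith
  · have hly : Real.log L ≤ y := Real.log_le_log hL0 (by nlinarith)
    have hlogr : -Real.log (1 - q) ≤ y := by
      have : 0 ≤ Real.log ((1 - q) * L) := Real.log_nonneg hrL1.le
      rw [Real.log_mul hr.ne' hL0.ne'] at this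
      linarith
    refine key2 m (2 * (1 - q)) hm3 hmL ?_ ?_
    · have h3 := exp_neg_two_mul_le_pow (k := 1) (a := 1 - q) hr.le hr2 (by simp)
      rwa [sub_sub_cancel, pow_one] at h3
    · have h3 : (m : ℝ) * -Real.log (1 - q) ≤ m * y := by gcongr
      have h4 : L * ((1 - q) * (m : ℝ) ^ 2) ≤ L * (L / 10) := by
        calc L * ((1 - q) * (m : ℝ) ^ 2) = ((1 - q) * L) * m ^ 2 := by ring
          _ ≤ (1000 * y ^ 2) * m ^ 2 := by
            refine mul_le_mul_of_nonneg_right (hrup.trans ?_) (by positivity)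
            gcongr
          _ = 1000 * (m * y) ^ 2 := by ring
          _ ≤ 1000 * (L / 100) ^ 2 := by gcongr
          _ = _ := by ring
      have h5 := le_of_mul_le_mul_left h4 hL0
      nlinarith

/-- Three regimes for the order of magnitude of `E(LDS(π))` when `π ~ μ_{n,q}`. -/
theorem mallows_expected_LDS_regimes :
    ∃ C₀ c₁ c C : ℝ, 0 < C₀ ∧ 0 < c₁ ∧ 0 < c ∧ c ≤ C ∧
      ∀ (n : ℕ) (q : ℝ), 2 ≤ n → 0 < q → q < 1 →
        ((1 - C₀ / (Real.log n) ^ 2 ≤ q ∧ q ≤ 1 - 4 / (n : ℝ) →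
            c / Real.sqrt (1 - q) ≤ mallowsExp n q (fun π => (LDS π : ℝ)) ∧
            mallowsExp n q (fun π => (LDS π : ℝ)) ≤ C / Real.sqrt (1 - q)) ∧
         (1 - c₁ * (Real.log (Real.log n)) ^ 2 / Real.log n ≤ q ∧
              q ≤ 1 - C₀ / (Real.log n) ^ 2 →
            c * Real.log n / Real.log ((1 - q) * (Real.log n) ^ 2) ≤
                mallowsExp n q (fun π => (LDS π : ℝ)) ∧
            mallowsExp n q (fun π => (LDS π : ℝ)) ≤
                C * Real.log n / Real.log ((1 - q) * (Real.log n) ^ 2)) ∧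
         (1 / (n : ℝ) ≤ q ∧ q ≤ 1 - c₁ * (Real.log (Real.log n)) ^ 2 / Real.log n →
            c * Real.sqrt (Real.log n / Real.log (1 / q)) ≤
                mallowsExp n q (fun π => (LDS π : ℝ)) ∧
            mallowsExp n q (fun π => (LDS π : ℝ)) ≤
                C * Real.sqrt (Real.log n / Real.log (1 / q)))) := by
  refine ⟨10 ^ 36, 1000, 1 / 1000, 10 ^ 19, by norm_num, by norm_num, by norm_num, by norm_num, ?_⟩
  intro n q hn hq hq1
  refine ⟨fun h => ⟨?_, ?_⟩, fun h => ⟨?_, ?_⟩, fun h => ⟨?_, ?_⟩⟩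
  · exact le_mallowsExp_LDS_of_near_one hn hq hq1 h.2
  · exact mallowsExp_LDS_le_of_near_one hn hq hq1 h.1 h.2
  · exact le_mallowsExp_LDS_of_intermediate hn hq hq1 h.1 h.2
  · exact mallowsExp_LDS_le_of_intermediate hn hq hq1 h.2
  · exact le_mallowsExp_LDS_of_far hn hq hq1 h.2
  · exact mallowsExp_LDS_le_of_far hn hq hq1 h.1 h.2
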